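/- arXiv:2411.04626 — 10 statements merged into one kernel-verified Lean document; each statement's English description precedes it below -/
import Mathlib

section
/- Under the LWR setup, define ψ : U → M₂(ℂ) by ψ(z) := (λ1−λ0)·(∂Φ/∂λ)(λ0,z)·Φ(λ0,z)⁻¹. Then ψ is holomorphic on U, tr ψ(z) = 0 for all z ∈ U, and its derivative satisfies ψ′(z) = (λ1−λ0)·Φ(λ0,z)·A(z)·Φ(λ0,z)⁻¹ for all z ∈ U; in particular det ψ′(z) = 0 everywhere, so ψ is a holomorphic null curve into sl₂ℂ. -/
open Matrix

attribute [local instance] Matrix.normedAddCommGroup Matrix.normedSpace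

/-- 2×2 complex matrices. -/
abbrev M2 : Type := Matrix (Fin 2) (Fin 2) ℂ

open Metric in
/-- Partial derivatives commute: if `g` is the `z`-derivative of `f` and both are entire in `l`, with `g` jointly
continuous, then the `l`-derivative of `g` is the `z`-derivative of the `l`-derivative
of `f`. -/
theorem hasDerivAt_deriv_of_hasDerivAt {E : Type*} [NormedAddCommGroup E] [NormedSpace ℂ E]
    [CompleteSpace E] {U : Set ℂ} (hU : IsOpen U) {f g : ℂ → ℂ → E}
    (hg : ContinuousOn (fun p : ℂ × ℂ => g p.1 p.2) (Set.univ ×ˢ U))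
    (hfl : ∀ z ∈ U, Differentiable ℂ (fun l => f l z))
    (hgl : ∀ z ∈ U, Differentiable ℂ (fun l => g l z))
    (hfg : ∀ l, ∀ z ∈ U, HasDerivAt (f l) (g l z) z) {z : ℂ} (hz : z ∈ U) (c : ℂ) :
    HasDerivAt (fun w => deriv (fun l => f l w) c) (deriv (fun l => g l z) c) z := by
  obtain ⟨r, hr, hrU⟩ := nhds_basis_closedBall.mem_iff.1 (hU.mem_nhds hz)
  obtain ⟨C, hC⟩ := ((isCompact_sphere c 1).prod
    (isCompact_closedBall z r)).exists_bound_of_continuousOn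
    (hg.mono (Set.prod_mono (Set.subset_univ _) hrU))
  let k : ℝ → ℂ := fun θ => deriv (circleMap c 1) θ * (1 / (circleMap c 1 θ - c) ^ 2)
  have hk : Continuous k := by
    have h0 : ∀ θ, (circleMap c 1 θ - c) ^ 2 ≠ 0 := fun θ =>
      pow_ne_zero 2 (sub_ne_zero.2 (circleMap_ne_center one_ne_zero))
    simp only [k, deriv_circleMap]
    have h1 := continuous_circleMap c 1
    have h2 := continuous_circleMap 0 1
    fun_prop (disch := exact h0 _)
  have hcont : ∀ h : ℂ → ℂ → E, (∀ z ∈ U, Differentiable ℂ (fun l => h l z)) → ∀ w ∈ U,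
      Continuous (fun θ => k θ • h (circleMap c 1 θ) w) := fun h hh w hw =>
    hk.smul ((hh w hw).continuous.comp (continuous_circleMap c 1))
  have hcauchy : ∀ h : ℂ → ℂ → E, (∀ z ∈ U, Differentiable ℂ (fun l => h l z)) → ∀ w ∈ U,
      deriv (fun l => h l w) c = (2 * Real.pi * Complex.I : ℂ)⁻¹ •
        ∫ θ in (0 : ℝ)..2 * Real.pi, k θ • h (circleMap c 1 θ) w := by
    intro h hh w hw
    rw [eq_inv_smul_iff₀ Complex.two_pi_I_ne_zero,
      ← (hh w hw).differentiableOn.deriv_eq_smul_circleIntegral one_pos]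
    simp only [circleIntegral, k, smul_smul]
  have key := (intervalIntegral.hasDerivAt_integral_of_dominated_loc_of_deriv_le
    (μ := MeasureTheory.volume) (a := 0) (b := 2 * Real.pi)
    (F := fun w θ => k θ • f (circleMap c 1 θ) w) (F' := fun w θ => k θ • g (circleMap c 1 θ) w)
    (bound := fun θ => ‖k θ‖ * C) (closedBall_mem_nhds z hr)
    (by
      filter_upwards [hU.mem_nhds hz] with w hw
      exact (hcont f hfl w hw).aestronglyMeasurable)
    ((hcont f hfl z hz).intervalIntegrable _ _)
    (hcont g hgl z hz).aestronglyMeasurable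
    (.of_forall fun θ _ w hw => by
      rw [norm_smul]
      exact mul_le_mul_of_nonneg_left
        (hC (circleMap c 1 θ, w) ⟨circleMap_mem_sphere c zero_le_one θ, hw⟩) (norm_nonneg _))
    ((hk.norm.mul continuous_const).intervalIntegrable _ _)
    (.of_forall fun θ _ w hw => (hfg _ w (hrU hw)).const_smul (k θ))).2
  rw [hcauchy g hgl z hz]
  refine (key.const_smul _).congr_of_eventuallyEq ?_
  filter_upwards [hU.mem_nhds hz] with w hw
  exact hcauchy f hfl w hw

theorem Matrix.hasDerivAt_iff {m n : Type*} [Fintype m] [Fintype n] {f : ℂ → Matrix m n ℂ}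
    {f' : Matrix m n ℂ} {z : ℂ} :
    HasDerivAt f f' z ↔ ∀ i j, HasDerivAt (fun w => f w i j) (f' i j) z :=
  (hasDerivAt_pi (φ := f) (φ' := f')).trans (forall_congr' fun _ => hasDerivAt_pi)

theorem Matrix.continuousOn_iff {X m n : Type*} [TopologicalSpace X] [Fintype m] [Fintype n]
    {f : X → Matrix m n ℂ} {s : Set X} :
    ContinuousOn f s ↔ ∀ i j, ContinuousOn (fun w => f w i j) s :=
  (continuousOn_pi (f := f)).trans (forall_congr' fun _ => continuousOn_pi)

theorem Matrix.inv_fin_two_of_det_eq_one {M : M2} (h : M.det = 1) :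
    M⁻¹ = !![M 1 1, -M 0 1; -M 1 0, M 0 0] := by
  rw [Matrix.inv_def, h, Ring.inverse_one, one_smul, Matrix.adjugate_fin_two]

/-- Under the LWR setup, the map
`ψ(z) := (λ1−λ0)·(∂Φ/∂λ)(λ0,z)·Φ(λ0,z)⁻¹` is holomorphic on `U`, trace-free, and
its derivative is `ψ′(z) = (λ1−λ0)·Φ(λ0,z)·A(z)·Φ(λ0,z)⁻¹`, whose determinant
vanishes everywhere; so `ψ` is a holomorphic null curve into `sl₂ℂ`.
Here `Φl` denotes the partial derivative of `Φ` with respect to the loop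
parameter `λ`, and `l0 ≠ l1` are the evaluation points. -/
theorem lwr_null_curve_sl2
    (U : Set ℂ) (hU : IsOpen U)
    (A B : ℂ → M2) (Φ Φl : ℂ → ℂ → M2)
    (hA : DifferentiableOn ℂ A U) (hB : DifferentiableOn ℂ B U)
    (htrA : ∀ z ∈ U, (A z).trace = 0) (htrB : ∀ z ∈ U, (B z).trace = 0)
    (hA2 : ∀ z ∈ U, A z * A z = 0)
    (hΦ : DifferentiableOn ℂ (fun p : ℂ × ℂ => Φ p.1 p.2) (Set.univ ×ˢ U))
    (hΦdet : ∀ μ : ℂ, ∀ z ∈ U, (Φ μ z).det = 1)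
    (hΦz : ∀ μ : ℂ, ∀ z ∈ U, HasDerivAt (fun w => Φ μ w) (Φ μ z * (μ • A z + B z)) z)
    (hΦl : ∀ μ : ℂ, ∀ z ∈ U, HasDerivAt (fun l => Φ l z) (Φl μ z) μ)
    (l0 l1 : ℂ) (hl : l0 ≠ l1) :
    ∀ z ∈ U,
      HasDerivAt (fun w => (l1 - l0) • (Φl l0 w * (Φ l0 w)⁻¹))
        ((l1 - l0) • (Φ l0 z * A z * (Φ l0 z)⁻¹)) z ∧
      ((l1 - l0) • (Φl l0 z * (Φ l0 z)⁻¹)).trace = 0 ∧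
      ((l1 - l0) • (Φ l0 z * A z * (Φ l0 z)⁻¹)).det = 0 := by
  have hΦc := Matrix.continuousOn_iff.1 hΦ.continuousOn
  have hsnd : Set.MapsTo Prod.snd ((Set.univ : Set ℂ) ×ˢ U) U := fun p hp => hp.2
  have hAc := fun i j => (Matrix.continuousOn_iff.1 hA.continuousOn i j).comp
    continuousOn_snd hsnd
  have hBc := fun i j => (Matrix.continuousOn_iff.1 hB.continuousOn i j).comp
    continuousOn_snd hsnd
  have hΦz' := fun μ z hz => Matrix.hasDerivAt_iff.1 (hΦz μ z hz)
  have hΦl' := fun μ z hz => Matrix.hasDerivAt_iff.1 (hΦl μ z hz)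
  have hGl : ∀ μ : ℂ, ∀ z ∈ U, ∀ i j,
      HasDerivAt (fun l => (Φ l z * (l • A z + B z)) i j)
        ((Φl μ z * (μ • A z + B z) + Φ μ z * A z) i j) μ := by
    intro μ z hz i j
    simp only [Matrix.mul_apply, Matrix.add_apply, Matrix.smul_apply, smul_eq_mul,
      Fin.sum_univ_two]
    have h := fun k => (hΦl' μ z hz i k).mul
      (((hasDerivAt_id μ).mul_const (A z k j)).add_const (B z k j))
    refine ((h 0).add (h 1)).congr_deriv ?_
    simp only [id]
    ring
  have hΦlz : ∀ z ∈ U, ∀ i j, HasDerivAt (fun w => Φl l0 w i j)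
      ((Φl l0 z * (l0 • A z + B z) + Φ l0 z * A z) i j) z := by
    intro z hz i j
    have h := hasDerivAt_deriv_of_hasDerivAt hU (f := fun l w => Φ l w i j)
      (g := fun l w => (Φ l w * (l • A w + B w)) i j)
      (by
        simp only [Matrix.mul_apply, Matrix.add_apply, Matrix.smul_apply, smul_eq_mul]
        exact continuousOn_finsetSum _ fun k _ => (hΦc i k).mul
          ((continuousOn_fst.mul (hAc k j)).add (hBc k j)))
      (fun z hz l => (hΦl' l z hz i j).differentiableAt)
      (fun z hz l => (hGl l z hz i j).differentiableAt)
      (fun l z hz => hΦz' l z hz i j) hz l0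
    rw [(hGl l0 z hz i j).deriv] at h
    refine h.congr_of_eventuallyEq ?_
    filter_upwards [hU.mem_nhds hz] with w hw
    exact (hΦl' l0 w hw i j).deriv.symm
  intro z hz
  have hdetz := hΦdet l0 z hz
  have htA := htrA z hz
  have htB := htrB z hz
  rw [Matrix.trace_fin_two] at htA htB
  refine ⟨?_, ?_, ?_⟩
  · have hinv : ∀ i j, HasDerivAt (fun w => (Φ l0 w)⁻¹ i j)
        ((-((l0 • A z + B z) * (Φ l0 z)⁻¹)) i j) z := by
      have hd := hΦz' l0 z hz
      have hev : ∀ i j, (fun w => (Φ l0 w)⁻¹ i j) =ᶠ[nhds z]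
          fun w => !![Φ l0 w 1 1, -Φ l0 w 0 1; -Φ l0 w 1 0, Φ l0 w 0 0] i j := by
        intro i j
        filter_upwards [hU.mem_nhds hz] with w hw
        rw [Matrix.inv_fin_two_of_det_eq_one (hΦdet l0 w hw)]
      intro i j
      refine HasDerivAt.congr_of_eventuallyEq ?_ (hev i j)
      rw [Matrix.inv_fin_two_of_det_eq_one hdetz]
      have hA1 : A z 1 1 = -A z 0 0 := by linear_combination htA
      have hB1 : B z 1 1 = -B z 0 0 := by linear_combination htB
      fin_cases i <;> fin_cases j
      · refine (hd 1 1).congr_deriv ?_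
        simp [Matrix.mul_apply, Fin.sum_univ_two, hA1, hB1]
        ring
      · refine (hd 0 1).neg.congr_deriv ?_
        simp [Matrix.mul_apply, Fin.sum_univ_two, hA1, hB1]
        ring
      · refine (hd 1 0).neg.congr_deriv ?_
        simp [Matrix.mul_apply, Fin.sum_univ_two, hA1, hB1]
        ring
      · refine (hd 0 0).congr_deriv ?_
        simp [Matrix.mul_apply, Fin.sum_univ_two, hA1, hB1]
        ring
    have hψ : Φ l0 z * A z * (Φ l0 z)⁻¹ =
        (Φl l0 z * (l0 • A z + B z) + Φ l0 z * A z) * (Φ l0 z)⁻¹ +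
          Φl l0 z * (-((l0 • A z + B z) * (Φ l0 z)⁻¹)) := by
      noncomm_ring
    refine HasDerivAt.const_smul (l1 - l0) (Matrix.hasDerivAt_iff.2 fun i j => ?_)
    rw [hψ]
    simp only [Matrix.add_apply _ _ i j, Matrix.mul_apply (i := i) (k := j),
      ← Finset.sum_add_distrib]
    exact HasDerivAt.fun_sum fun k _ => (hΦlz z hz i k).mul (hinv k j)
  · have hd := hΦl' l0 z hz
    have h := ((hd 0 0).mul (hd 1 1)).sub ((hd 0 1).mul (hd 1 0))
    have h1 : HasDerivAt (fun _ : ℂ => (1 : ℂ)) _ l0 := h.congr_of_eventuallyEq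
      (.of_forall fun μ => by simpa [Matrix.det_fin_two] using (hΦdet μ z hz).symm)
    have h0 := h1.unique (hasDerivAt_const l0 1)
    rw [Matrix.trace_smul, Matrix.inv_fin_two_of_det_eq_one hdetz, Matrix.trace_fin_two]
    simp only [Matrix.mul_apply, Fin.sum_univ_two, Matrix.of_apply, Matrix.cons_val',
      Matrix.cons_val_zero, Matrix.cons_val_one, smul_eq_mul]
    linear_combination (l1 - l0) * h0
  · have hdA : (A z).det = 0 := by
      have := congrArg Matrix.det (hA2 z hz)
      simpa [Matrix.det_mul] using this
    simp [Matrix.det_mul, hdA]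
end

section
/- Let λ0 ≠ λ1 ∈ ℂ, let D ⊆ ℂ be a nonempty open simply connected set, and let ψ : D → M₂(ℂ) be holomorphic with tr ψ(z) = 0 and det ψ′(z) = 0 for all z ∈ D. Then there exists Φ : ℂ × D → M₂(ℂ), holomorphic in (λ,z), with det Φ(λ,z) = 1 everywhere, satisfying the linear equation ∂Φ/∂z(λ,z) = Φ(λ,z)·((λ−λ0)/(λ1−λ0))·ψ′(z) for all (λ,z), and such that ψ(z) = (λ1−λ0)·(∂Φ/∂λ)(λ0,z)·Φ(λ0,z)⁻¹ for all z ∈ D; that is, every holomorphic null curve into sl₂ℂ arises locally from the Loop Weierstrass Representation. -/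
open Matrix

attribute [local instance] Matrix.normedAddCommGroup Matrix.normedSpace

open Set Topology Metric in
/-- Additive locally constant transition data on a simply connected, locally path connected space
are a coboundary: local potentials `P x`, defined near `x` and differing by locally constant
functions, can be corrected by constants to a global one. -/
theorem exists_global_potential {X E : Type*} [TopologicalSpace X] [SimplyConnectedSpace X]
    [LocallyPathConnectedSpace X] [AddCommGroup E] (U : X → Set X) (hU : ∀ x, IsOpen (U x))
    (hx : ∀ x, x ∈ U x) (P : X → X → E)
    (hP : ∀ i j, ∃ c, ∀ x ∈ U i ∩ U j, P i x - P j x = c) :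
    ∃ F : X → E, ∀ i, ∀ᶠ y in 𝓝 i, F y - P i y = F i - P i i := by
  let _ : TopologicalSpace E := ⊥
  have _ : DiscreteTopology E := ⟨rfl⟩
  let Z : FiberBundleCore X X E :=
    { baseSet := U
      isOpen_baseSet := hU
      indexAt := id
      mem_baseSet_at := hx
      coordChange := fun i j x v => v + (P i x - P j x)
      coordChange_self := by simp
      continuousOn_coordChange := by
        intro i j
        obtain ⟨c, hc⟩ := hP i j
        have : Continuous (fun p : X × E => p.2 + c) :=
          (continuous_of_discreteTopology (f := fun v : E => v + c)).comp continuous_snd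
        refine this.continuousOn.congr ?_
        rintro ⟨x, v⟩ hxv
        simp [hc x hxv.1]
      coordChange_comp := by
        intro i j k x _ v
        abel }
  have hcov : IsCoveringMap (Bundle.TotalSpace.proj : Z.TotalSpace → X) :=
    FiberBundle.isCoveringMap (F := E) (E := Z.Fiber)
  obtain ⟨x₀⟩ : Nonempty X := inferInstance
  obtain ⟨g, ⟨-, hg⟩, -⟩ := hcov.existsUnique_continuousMap_lifts (ContinuousMap.id X) x₀
    (⟨x₀, (0 : E)⟩ : Z.TotalSpace) rfl
  have hg' : ∀ x, (g x).1 = x := fun x => congrFun hg x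
  let v : X → E := fun x => (g x).2
  refine ⟨fun x => P x x + v x, fun i => ?_⟩
  have hcont : ContinuousAt (fun x => (Z.localTriv i (g x)).2) i := by
    refine continuous_snd.continuousAt.comp (ContinuousAt.comp ?_ g.continuous.continuousAt)
    refine (Z.localTriv i).continuousAt ?_
    rw [FiberBundleCore.mem_localTriv_source, hg']
    exact hx i
  have hval : ∀ x, (Z.localTriv i (g x)).2 = v x + (P x x - P i x) := by
    intro x
    change v x + (P (g x).1 (g x).1 - P i (g x).1) = _
    rw [hg']
  have hev := hcont.eventually_mem (isOpen_discrete {(Z.localTriv i (g i)).2} |>.mem_nhds rfl)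
  filter_upwards [hev] with y hy
  have hy' : (Z.localTriv i (g y)).2 = (Z.localTriv i (g i)).2 := hy
  rw [hval, hval] at hy'
  have e : ∀ a b c : E, a + b - c = b + (a - c) := fun a b c => by abel
  rw [e, e, hy']

open Set Topology Metric Complex in
/-- Holomorphic functions on open simply connected subsets of `ℂ` have primitives. -/
theorem DifferentiableOn.isExactOn_of_isSimplyConnected {E : Type*} [NormedAddCommGroup E]
    [NormedSpace ℂ E] [CompleteSpace E] {D : Set ℂ} {f : ℂ → E} (hf : DifferentiableOn ℂ f D)
    (hD : IsOpen D) (hsc : IsSimplyConnected D) : IsExactOn f D := by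
  classical
  have := hsc.simplyConnectedSpace
  have := hD.locallyPathConnectedSpace
  have hr : ∀ x : D, ∃ r > 0, ball (x : ℂ) r ⊆ D := fun x => Metric.isOpen_iff.mp hD x x.2
  choose r hr0 hrD using hr
  have hP : ∀ x : D, IsExactOn f (ball (x : ℂ) (r x)) := fun x =>
    (hf.mono (hrD x)).isExactOn_ball
  choose P hP using hP
  obtain ⟨F, hF⟩ := exists_global_potential (X := D) (E := E)
    (fun x => Subtype.val ⁻¹' ball (x : ℂ) (r x))
    (fun x => isOpen_ball.preimage continuous_subtype_val)
    (fun x => mem_ball_self (hr0 x)) (fun i x => P i x) (by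
      intro i j
      have hpre : IsPreconnected (ball (i : ℂ) (r i) ∩ ball (j : ℂ) (r j)) :=
        ((convex_ball _ _).inter (convex_ball _ _)).isPreconnected
      have hder : ∀ x ∈ ball (i : ℂ) (r i) ∩ ball (j : ℂ) (r j),
          HasDerivAt (fun x => P i x - P j x) 0 x := fun x hx => by
        simpa using (hP i x hx.1).fun_sub (hP j x hx.2)
      obtain ⟨c, hc⟩ := (isOpen_ball.inter isOpen_ball).exists_is_const_of_deriv_eq_zero hpre
        (fun x hx => (hder x hx).differentiableAt.differentiableWithinAt)
        (fun x hx => (hder x hx).deriv)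
      exact ⟨c, fun x hx => hc x hx⟩)
  refine ⟨fun z => if h : z ∈ D then F ⟨z, h⟩ else 0, fun z hz => ?_⟩
  have hev : ∀ᶠ w in 𝓝 z, ∀ h : w ∈ D, F ⟨w, h⟩ - P ⟨z, hz⟩ w = F ⟨z, hz⟩ - P ⟨z, hz⟩ z := by
    have := hF ⟨z, hz⟩
    rw [nhds_subtype_eq_comap, Filter.eventually_comap] at this
    filter_upwards [this] with w hw h using hw ⟨w, h⟩ rfl
  refine ((hP ⟨z, hz⟩ z (mem_ball_self (hr0 _))).add_const
    (F ⟨z, hz⟩ - P ⟨z, hz⟩ z)).congr_of_eventuallyEq ?_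
  filter_upwards [hev, hD.mem_nhds hz] with w hw hwD
  rw [dif_pos hwD, ← hw hwD]
  abel

open Set Metric in
/-- Along a segment, Picard iterates of a linear equation grow at most factorially. -/
theorem norm_le_pow_div_factorial_of_hasDerivAt {E : Type*} [NormedAddCommGroup E]
    [NormedSpace ℂ E] {s : Set ℂ} (hs : Convex ℝ s) {R : ℂ → E →L[ℂ] E} {M : ℝ}
    (hR : ∀ z ∈ s, ‖R z‖ ≤ M) {A : ℕ → ℂ → E} (hA₀ : ∀ x ∈ s, ∀ y ∈ s, A 0 y = A 0 x)
    (hA : ∀ n, ∀ z ∈ s, HasDerivAt (A (n + 1)) (R z (A n z)) z) {x : ℂ} (hx : x ∈ s) {K a : ℝ}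
    (hK : ∀ n, ‖A n x‖ ≤ K * (a ^ n / n.factorial)) (n : ℕ) :
    ∀ y ∈ s, ‖A n y‖ ≤ K * ((a + M * ‖y - x‖) ^ n / n.factorial) := by
  induction n with
  | zero =>
    intro y hy
    simpa [hA₀ x hx y hy] using hK 0
  | succ n ih =>
    intro y hy
    have hM : 0 ≤ M := (norm_nonneg _).trans (hR x hx)
    let γ : ℝ → ℂ := fun t => x + t * (y - x)
    have hγs : ∀ t ∈ Icc (0 : ℝ) 1, γ t ∈ s := by
      intro t ht
      simpa [γ] using hs.add_smul_sub_mem hx hy ht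
    have hγ : ∀ t, HasDerivAt γ (y - x) t := fun t => by
      simpa [γ] using ((Complex.ofRealCLM.hasDerivAt (x := t)).mul_const (y - x)).const_add x
    have hf : ∀ t ∈ Icc (0 : ℝ) 1, HasDerivAt (fun t => A (n + 1) (γ t))
        ((y - x) • R (γ t) (A n (γ t))) t := fun t ht =>
      (hA n _ (hγs t ht)).scomp t (hγ t)
    have hfac : ((n + 1).factorial : ℝ) = (n + 1) * n.factorial := by
      simp [Nat.factorial_succ]
    have hn0 : (n.factorial : ℝ) ≠ 0 := by positivity
    have hn1 : (n + 1 : ℝ) ≠ 0 := by positivity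
    have hB : ∀ t : ℝ, HasDerivAt
        (fun t => K * ((a + M * (t * ‖y - x‖)) ^ (n + 1) / (n + 1).factorial))
        (K * ((a + M * (t * ‖y - x‖)) ^ n / n.factorial) * (M * ‖y - x‖)) t := fun t => by
      have h := (((((hasDerivAt_id t).mul_const ‖y - x‖).const_mul M).const_add a).pow
        (n + 1)).div_const ((n + 1).factorial : ℝ) |>.const_mul K
      refine h.congr_deriv ?_
      rw [hfac]
      simp
      field_simp
    have key := image_norm_le_of_norm_deriv_right_le_deriv_boundary
      (fun t ht => (hf t ht).continuousAt.continuousWithinAt)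
      (fun t ht => (hf t (Ico_subset_Icc_self ht)).hasDerivWithinAt)
      (by simpa [γ] using hK (n + 1)) hB (fun t ht => by
        have ht' := Ico_subset_Icc_self ht
        have h1 : ‖γ t - x‖ = t * ‖y - x‖ := by
          simp [γ, abs_of_nonneg ht'.1]
        have h2 := ih (γ t) (hγs t ht')
        rw [h1] at h2
        calc ‖(y - x) • R (γ t) (A n (γ t))‖ = ‖y - x‖ * ‖R (γ t) (A n (γ t))‖ := norm_smul _ _
          _ ≤ ‖y - x‖ * (M * (K * ((a + M * (t * ‖y - x‖)) ^ n / n.factorial))) := by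
            gcongr
            exact (R (γ t)).le_of_opNorm_le_of_le (hR _ (hγs t ht')) h2
          _ = _ := by ring) (right_mem_Icc.mpr zero_le_one)
    simpa [γ] using key

open Set Metric Topology in
/-- Picard iterates of a linear equation on a connected open set grow, locally uniformly,
at most factorially. -/
theorem exists_ball_norm_le_pow_div_factorial {E : Type*} [NormedAddCommGroup E]
    [NormedSpace ℂ E] {D : Set ℂ} (hD : IsOpen D) (hconn : IsPreconnected D)
    {R : ℂ → E →L[ℂ] E} (hR : ContinuousOn R D) {A : ℕ → ℂ → E} {e : E}
    (hA₀ : ∀ z, A 0 z = e) (hA : ∀ n, ∀ z ∈ D, HasDerivAt (A (n + 1)) (R z (A n z)) z)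
    {z₀ : ℂ} (hz₀ : z₀ ∈ D) (hAz₀ : ∀ n, A (n + 1) z₀ = 0) {z : ℂ} (hz : z ∈ D) :
    ∃ r > 0, ball z r ⊆ D ∧ ∃ M a : ℝ, 1 ≤ a ∧ (∀ w ∈ ball z r, ‖R w‖ ≤ M) ∧
      ∀ w ∈ ball z r, ∀ n, ‖A n w‖ ≤ ‖e‖ * (a ^ n / n.factorial) := by
  have hloc : ∀ z ∈ D, ∃ r > 0, ball z r ⊆ D ∧ ∃ M, ∀ w ∈ ball z r, ‖R w‖ ≤ M := by
    intro z hz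
    have h : ∀ᶠ w in 𝓝 z, w ∈ D ∧ ‖R w‖ < ‖R z‖ + 1 :=
      (hD.eventually_mem hz).and
        ((hR.continuousAt (hD.mem_nhds hz)).norm.eventually_lt_const (lt_add_one _))
    obtain ⟨r, hr, h⟩ := Metric.eventually_nhds_iff_ball.mp h
    exact ⟨r, hr, fun w hw => (h w hw).1, _, fun w hw => (h w hw).2.le⟩
  let S : Set ℂ := {z | ∃ a : ℝ, 1 ≤ a ∧ ∀ n, ‖A n z‖ ≤ ‖e‖ * (a ^ n / n.factorial)}
  have hprop : ∀ z r M, ball z r ⊆ D → (∀ w ∈ ball z r, ‖R w‖ ≤ M) → ∀ x ∈ ball z r, x ∈ S →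
      ∃ a : ℝ, 1 ≤ a ∧ ∀ w ∈ ball z r, ∀ n, ‖A n w‖ ≤ ‖e‖ * (a ^ n / n.factorial) := by
    rintro z r M hball hM x hx ⟨a, ha, hax⟩
    have hM0 : 0 ≤ M := (norm_nonneg _).trans (hM x hx)
    have hr : 0 < r := pos_of_mem_ball hx
    refine ⟨a + M * (2 * r), le_add_of_le_of_nonneg ha (by positivity), fun w hw n => ?_⟩
    refine (norm_le_pow_div_factorial_of_hasDerivAt (convex_ball z r) hM
      (fun _ _ _ _ => by rw [hA₀, hA₀]) (fun n w hw => hA n w (hball hw)) hx hax n w hw).trans ?_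
    have : ‖w - x‖ ≤ 2 * r := by
      rw [← dist_eq_norm]
      linarith [dist_triangle_right w x z, mem_ball.mp hw, mem_ball.mp hx]
    gcongr
  have hSz₀ : z₀ ∈ S := by
    refine ⟨1, le_rfl, fun n => ?_⟩
    cases n with
    | zero => simp [hA₀]
    | succ n => rw [hAz₀, norm_zero]; positivity
  have hmem : ∀ z ∈ D, (∃ᶠ x in 𝓝 z, x ∈ S) → ∀ᶠ x in 𝓝 z, x ∈ S := by
    intro z hz hfreq
    obtain ⟨r, hr, hball, M, hM⟩ := hloc z hz
    obtain ⟨x, hxS, hx⟩ := (hfreq.and_eventually (ball_mem_nhds z hr)).exists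
    obtain ⟨a, ha, hb⟩ := hprop z r M hball hM x hx hxS
    filter_upwards [ball_mem_nhds z hr] with w hw using ⟨a, ha, hb w hw⟩
  have hDS : D ⊆ interior S := by
    refine hconn.subset_of_closure_inter_subset isOpen_interior
      ⟨z₀, hz₀, mem_interior_iff_mem_nhds.mpr
        (hmem z₀ hz₀ (mem_closure_iff_frequently.mp (subset_closure hSz₀)))⟩ ?_
    rintro w ⟨hw, hwD⟩
    exact mem_interior_iff_mem_nhds.mpr (hmem w hwD
      ((mem_closure_iff_frequently.mp hw).mono fun _ h => interior_subset h))
  obtain ⟨r, hr, hball, M, hM⟩ := hloc z hz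
  obtain ⟨a, ha, hb⟩ := hprop z r M hball hM z (mem_ball_self hr) (interior_subset (hDS hz))
  exact ⟨r, hr, hball, M, a, ha, hM, hb⟩

open Set Metric Topology in
/-- On an open simply connected set, the holomorphic linear equation `∂F/∂z = t R(z) F` with
spectral parameter `t` has a solution with constant initial value, jointly holomorphic in `(t, z)`;
its derivative at `t = 0` is the first Picard iterate. -/
theorem exists_holomorphic_linear_ode_solution {E : Type*} [NormedAddCommGroup E]
    [NormedSpace ℂ E] [CompleteSpace E] {D : Set ℂ} (hD : IsOpen D) (hsc : IsSimplyConnected D)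
    {R : ℂ → E →L[ℂ] E} (hR : DifferentiableOn ℂ R D) (e : E) {z₀ : ℂ} (hz₀ : z₀ ∈ D) :
    ∃ (F : ℂ → ℂ → E) (A : ℂ → E),
      (∀ t, ∀ z ∈ D, DifferentiableAt ℂ (fun p : ℂ × ℂ => F p.1 p.2) (t, z)) ∧
      (∀ t, F t z₀ = e) ∧ (∀ z, F 0 z = e) ∧
      (∀ t, ∀ z ∈ D, HasDerivAt (F t) (t • R z (F t z)) z) ∧
      A z₀ = 0 ∧ (∀ z ∈ D, HasDerivAt A (R z e) z) ∧
      (∀ z ∈ D, HasDerivAt (fun t => F t z) (A z) 0) := by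
  have hprim : ∀ f : ℂ → E, DifferentiableOn ℂ f D →
      ∃ g, g z₀ = 0 ∧ ∀ z ∈ D, HasDerivAt g (R z (f z)) z := fun f hf =>
    ((hR.clm_apply hf).isExactOn_of_isSimplyConnected hD hsc).with_val_at z₀ 0
  have hseq : ∀ f : {f : ℂ → E // DifferentiableOn ℂ f D},
      ∃ g : {f : ℂ → E // DifferentiableOn ℂ f D}, g.1 z₀ = 0 ∧ ∀ z ∈ D,
        HasDerivAt g.1 (R z (f.1 z)) z := fun f => by
    obtain ⟨g, hg₀, hg⟩ := hprim f.1 f.2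
    exact ⟨⟨g, fun z hz => (hg z hz).differentiableAt.differentiableWithinAt⟩, hg₀, hg⟩
  choose next hnext₀ hnext using hseq
  let A : ℕ → ℂ → E := fun n => (next^[n] ⟨fun _ => e, differentiableOn_const e⟩).1
  have hA₀ : ∀ z, A 0 z = e := fun _ => rfl
  have hAz₀ : ∀ n, A (n + 1) z₀ = 0 := fun n => by
    simp only [A, Function.iterate_succ_apply']
    exact hnext₀ _
  have hA : ∀ n, ∀ z ∈ D, HasDerivAt (A (n + 1)) (R z (A n z)) z := fun n z hz => by
    simp only [A, Function.iterate_succ_apply']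
    exact hnext _ z hz
  let A' : ℕ → ℂ → E := fun n z => Nat.casesOn n 0 fun m => R z (A m z)
  have hA' : ∀ n, ∀ z ∈ D, HasDerivAt (A n) (A' n z) z := by
    intro n z hz
    cases n with
    | zero => exact hasDerivAt_const z e
    | succ n => exact hA n z hz
  let G' : ℕ → ℂ × ℂ → (ℂ × ℂ →L[ℂ] E) := fun n p =>
    p.1 ^ n • (ContinuousLinearMap.snd ℂ ℂ ℂ).smulRight (A' n p.2) +
      ((n * p.1 ^ (n - 1)) • ContinuousLinearMap.fst ℂ ℂ ℂ).smulRight (A n p.2)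
  have hG : ∀ n, ∀ p : ℂ × ℂ, p.2 ∈ D →
      HasFDerivAt (fun p : ℂ × ℂ => p.1 ^ n • A n p.2) (G' n p) p := by
    intro n p hp
    have h1 : HasFDerivAt (fun p : ℂ × ℂ => p.1 ^ n)
        ((n * p.1 ^ (n - 1)) • ContinuousLinearMap.fst ℂ ℂ ℂ) p :=
      (hasDerivAt_pow n p.1).comp_hasFDerivAt p hasFDerivAt_fst
    have h2 : HasFDerivAt (fun p : ℂ × ℂ => A n p.2)
        ((ContinuousLinearMap.snd ℂ ℂ ℂ).smulRight (A' n p.2)) p := by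
      have := (hA' n p.2 hp).hasFDerivAt.comp p hasFDerivAt_snd
      refine this.congr_fderiv ?_
      ext <;> simp
    exact h1.smul h2
  have key : ∀ t : ℂ, ∀ z ∈ D, (Summable fun n => t ^ n • A n z) ∧ Summable (fun n => G' n (t, z)) ∧
      HasFDerivAt (fun p : ℂ × ℂ => ∑' n, p.1 ^ n • A n p.2) (∑' n, G' n (t, z)) (t, z) := by
    intro t z hz
    obtain ⟨r, hr, hball, M, a, ha, hM, hb⟩ := exists_ball_norm_le_pow_div_factorial hD
      hsc.isPathConnected.isConnected.isPreconnected hR.continuousOn hA₀ hA hz₀ hAz₀ hz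
    have hM0 : 0 ≤ M := (norm_nonneg _).trans (hM z (mem_ball_self hr))
    set ρ : ℝ := ‖t‖ + 1 with hρ
    have hρ1 : 1 ≤ ρ := by linarith [norm_nonneg t]
    let u : ℕ → ℝ := fun n => (M + 1) * ‖e‖ * ((2 * a * ρ) ^ n / n.factorial)
    have hu : Summable u := (Real.summable_pow_div_factorial (2 * a * ρ)).mul_left _
    have hn2 : ∀ n : ℕ, (n : ℝ) ≤ 2 ^ n := fun n => by
      exact_mod_cast (Nat.lt_two_pow_self (n := n)).le
    have hbA' : ∀ w ∈ ball z r, ∀ n, ‖A' n w‖ ≤ M * (‖e‖ * ((2 * a) ^ n / n.factorial)) := by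
      intro w hw n
      cases n with
      | zero =>
        refine (norm_zero (E := E)).trans_le ?_
        positivity
      | succ n =>
        refine (R w).le_of_opNorm_le_of_le (hM w hw) ((hb w hw n).trans ?_)
        gcongr ‖e‖ * ?_
        rw [div_le_div_iff₀ (by positivity) (by positivity), Nat.factorial_succ]
        push_cast
        have h1 : a ^ n * (n + 1) ≤ (2 * a) ^ (n + 1) := by
          rw [mul_pow, mul_comm]
          refine mul_le_mul (mod_cast hn2 (n + 1)) (pow_le_pow_right₀ ha n.le_succ)
            (by positivity) (by positivity)
        calc a ^ n * ((n + 1) * n.factorial) = a ^ n * (n + 1) * n.factorial := by ring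
          _ ≤ _ := by gcongr
    have hbound : ∀ n, ∀ p ∈ ball (0 : ℂ) ρ ×ˢ ball z r, ‖G' n p‖ ≤ u n := by
      rintro n ⟨s, w⟩ ⟨hs, hw⟩
      have hs' : ‖s‖ ≤ ρ := by simpa using (mem_ball_zero_iff.mp hs).le
      have h1 : ‖s ^ n • (ContinuousLinearMap.snd ℂ ℂ ℂ).smulRight (A' n w)‖ ≤
          ρ ^ n * (M * (‖e‖ * ((2 * a) ^ n / n.factorial))) := by
        rw [norm_smul, norm_pow, ContinuousLinearMap.norm_smulRight_apply]
        have hA'w : ‖ContinuousLinearMap.snd ℂ ℂ ℂ‖ * ‖A' n w‖ ≤ _ :=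
          mul_le_mul (ContinuousLinearMap.norm_snd_le ℂ ℂ ℂ) (hbA' w hw n) (norm_nonneg _)
            zero_le_one
        rw [one_mul] at hA'w
        gcongr
      have h2 : ‖((n * s ^ (n - 1)) • ContinuousLinearMap.fst ℂ ℂ ℂ).smulRight (A n w)‖ ≤
          (2 ^ n * ρ ^ n) * (‖e‖ * (a ^ n / n.factorial)) := by
        rw [ContinuousLinearMap.norm_smulRight_apply, norm_smul, norm_mul, norm_pow,
          Complex.norm_natCast, ← mul_one (2 ^ n * ρ ^ n)]
        have hpow : ‖s‖ ^ (n - 1) ≤ ρ ^ n :=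
          (pow_le_pow_left₀ (norm_nonneg s) hs' _).trans (pow_le_pow_right₀ hρ1 (Nat.sub_le n 1))
        exact mul_le_mul (mul_le_mul (mul_le_mul (hn2 n) hpow (by positivity) (by positivity))
          (ContinuousLinearMap.norm_fst_le ℂ ℂ ℂ) (norm_nonneg _) (by positivity)) (hb w hw n)
          (norm_nonneg _) (by positivity)
      calc _ ≤ _ := norm_add_le _ _
        _ ≤ _ := add_le_add h1 h2
        _ = u n := by
          simp only [u, mul_pow]
          ring
    have hmem : (t, z) ∈ ball (0 : ℂ) ρ ×ˢ ball z r :=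
      ⟨by simp [hρ], mem_ball_self hr⟩
    have hmem0 : ((0 : ℂ), z) ∈ ball (0 : ℂ) ρ ×ˢ ball z r :=
      ⟨by simp only [mem_ball_self (zero_lt_one.trans_le hρ1)], mem_ball_self hr⟩
    refine ⟨?_, .of_norm_bounded hu fun n => hbound n _ hmem,
      hasFDerivAt_tsum_of_isPreconnected hu (isOpen_ball.prod isOpen_ball)
        ((convex_ball _ _).isPreconnected.prod (convex_ball _ _).isPreconnected)
        (fun n p hp => hG n p (hball hp.2)) hbound hmem0 ?_ hmem⟩
    · refine .of_norm_bounded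
        ((Real.summable_pow_div_factorial (‖t‖ * a)).mul_left ‖e‖) fun n => ?_
      rw [norm_smul, norm_pow]
      calc _ ≤ ‖t‖ ^ n * (‖e‖ * (a ^ n / n.factorial)) := by
            gcongr
            exact hb z (mem_ball_self hr) n
        _ = _ := by rw [mul_pow]; ring
    · exact summable_of_ne_finset_zero (s := {0}) fun n hn => by
        have : n ≠ 0 := by simpa using hn
        simp [this]
  have htsum₀ : ∀ {f : ℕ → E}, (∀ n, f (n + 1) = 0) → ∑' n, f n = f 0 := fun {f} hf =>
    tsum_eq_single 0 fun n hn => by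
      obtain ⟨m, rfl⟩ := Nat.exists_eq_succ_of_ne_zero hn
      exact hf m
  refine ⟨fun t z => ∑' n, t ^ n • A n z, A 1, fun t z hz => (key t z hz).2.2.differentiableAt,
    fun t => ?_, fun z => ?_, fun t z hz => ?_, hAz₀ 0, hA 0, fun z hz => ?_⟩
  · refine (htsum₀ fun n => ?_).trans ?_
    · rw [hAz₀, smul_zero]
    · simp [hA₀]
  · refine (htsum₀ fun n => ?_).trans ?_
    · simp
    · simp [hA₀]
  · obtain ⟨hs, hs', h⟩ := key t z hz
    have hd := h.comp_hasDerivAt z ((hasDerivAt_const z t).prodMk (hasDerivAt_id z))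
    refine hd.congr_deriv ?_
    have h1 : (∑' n, G' n (t, z)) (0, 1) = ∑' n, t ^ n • A' n z := by
      rw [← ContinuousLinearMap.apply_apply (𝕜 := ℂ) ((0, 1) : ℂ × ℂ) (∑' n, G' n (t, z)),
        ContinuousLinearMap.map_tsum _ hs']
      simp [G']
    have hs1 : Summable fun n => t ^ n • A' n z := by
      refine ((ContinuousLinearMap.apply ℂ E ((0, 1) : ℂ × ℂ)).summable hs').congr fun n => ?_
      simp [G']
    rw [h1, hs1.tsum_eq_zero_add, ContinuousLinearMap.map_tsum _ hs, ← tsum_const_smul'']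
    simp [A', pow_succ', mul_smul]
  · obtain ⟨hs, hs', h⟩ := key 0 z hz
    have hd := h.comp_hasDerivAt (0 : ℂ)
      ((hasDerivAt_id (0 : ℂ)).prodMk (hasDerivAt_const (0 : ℂ) z))
    refine hd.congr_deriv ?_
    rw [← ContinuousLinearMap.apply_apply (𝕜 := ℂ) ((1, 0) : ℂ × ℂ) (∑' n, G' n (0, z)),
      ContinuousLinearMap.map_tsum _ hs', tsum_eq_single 1]
    · simp [G']
    · intro n hn
      rcases n with _ | _ | n
      · simp [G']
      · simp at hn
      · simp [G']

theorem hasDerivAt_matrix_iff {X : ℂ → M2} {X' : M2} {z : ℂ} :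
    HasDerivAt X X' z ↔ ∀ i j, HasDerivAt (fun w => X w i j) (X' i j) z :=
  hasDerivAt_pi.trans (forall_congr' fun _ => hasDerivAt_pi)

theorem differentiableAt_matrix_iff {V : Type*} [NormedAddCommGroup V] [NormedSpace ℂ V]
    {X : V → M2} {v : V} :
    DifferentiableAt ℂ X v ↔ ∀ i j, DifferentiableAt ℂ (fun w => X w i j) v :=
  differentiableAt_pi.trans (forall_congr' fun _ => differentiableAt_pi)

theorem HasDerivAt.matrix_mul {X Y : ℂ → M2} {X' Y' : M2} {z : ℂ} (hX : HasDerivAt X X' z)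
    (hY : HasDerivAt Y Y' z) :
    HasDerivAt (fun w => X w * Y w) (X' * Y z + X z * Y') z := by
  rw [hasDerivAt_matrix_iff] at *
  intro i j
  simp only [Matrix.mul_apply, Matrix.add_apply, Fin.sum_univ_two]
  refine (((hX i 0).fun_mul (hY 0 j)).fun_add ((hX i 1).fun_mul (hY 1 j))).congr_deriv ?_
  ring

theorem DifferentiableAt.matrix_mul {V : Type*} [NormedAddCommGroup V] [NormedSpace ℂ V]
    {X Y : V → M2} {v : V} (hX : DifferentiableAt ℂ X v) (hY : DifferentiableAt ℂ Y v) :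
    DifferentiableAt ℂ (fun w => X w * Y w) v := by
  rw [differentiableAt_matrix_iff] at *
  intro i j
  simp only [Matrix.mul_apply, Fin.sum_univ_two]
  exact ((hX i 0).fun_mul (hY 0 j)).fun_add ((hX i 1).fun_mul (hY 1 j))

/-- Liouville's formula for trace-free coefficients. -/
theorem HasDerivAt.det_of_trace_eq_zero {X : ℂ → M2} {Y : M2} {z : ℂ}
    (hX : HasDerivAt X (X z * Y) z) (hY : Y.trace = 0) :
    HasDerivAt (fun w => (X w).det) 0 z := by
  rw [hasDerivAt_matrix_iff] at hX
  simp only [Matrix.det_fin_two]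
  refine (((hX 0 0).fun_mul (hX 1 1)).fun_sub ((hX 0 1).fun_mul (hX 1 0))).congr_deriv ?_
  simp only [Matrix.mul_apply, Fin.sum_univ_two]
  rw [Matrix.trace_fin_two] at hY
  linear_combination (X z 0 0 * X z 1 1 - X z 0 1 * X z 1 0) * hY

theorem HasDerivAt.trace_eq_zero {X : ℂ → M2} {X' : M2} {z : ℂ} {D : Set ℂ} (hD : IsOpen D)
    (hz : z ∈ D) (hX : HasDerivAt X X' z) (htr : ∀ w ∈ D, (X w).trace = 0) : X'.trace = 0 := by
  rw [hasDerivAt_matrix_iff] at hX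
  have h : HasDerivAt (fun w => (X w).trace) X'.trace z := by
    simp only [Matrix.trace_fin_two]
    exact (hX 0 0).fun_add (hX 1 1)
  refine h.unique ((hasDerivAt_const z (0 : ℂ)).congr_of_eventuallyEq ?_)
  filter_upwards [hD.mem_nhds hz] with w hw using htr w hw

theorem eqOn_of_hasDerivAt {E : Type*} [NormedAddCommGroup E] [NormedSpace ℂ E] {D : Set ℂ}
    (hD : IsOpen D) (hconn : IsPreconnected D) {f g f' : ℂ → E}
    (hf : ∀ z ∈ D, HasDerivAt f (f' z) z) (hg : ∀ z ∈ D, HasDerivAt g (f' z) z) {z₀ : ℂ}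
    (hz₀ : z₀ ∈ D) (h : f z₀ = g z₀) : Set.EqOn f g D :=
  hD.eqOn_of_deriv_eq hconn
    (fun z hz => (hf z hz).differentiableAt.differentiableWithinAt)
    (fun z hz => (hg z hz).differentiableAt.differentiableWithinAt)
    (fun z hz => (hf z hz).deriv.trans (hg z hz).deriv.symm) hz₀ h

/-- Every trace-free matrix is the velocity at `1` of an entire curve in `SL₂(ℂ)`. -/
theorem exists_differentiable_det_eq_one (B : M2) (hB : B.trace = 0) :
    ∃ G : ℂ → M2, Differentiable ℂ G ∧ (∀ t, (G t).det = 1) ∧ G 0 = 1 ∧ HasDerivAt G B 0 := by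
  let a := B 0 0
  let b := B 0 1
  let c := B 1 0
  have ha : B 1 1 = -a := by
    rw [Matrix.trace_fin_two] at hB
    linear_combination hB
  have hlin : ∀ k : ℂ, HasDerivAt (fun t : ℂ => t * k) k 0 := fun k => by
    simpa using (hasDerivAt_id (0 : ℂ)).mul_const k
  have hexp : ∀ k : ℂ, HasDerivAt (fun t : ℂ => Complex.exp (t * k)) k 0 := fun k => by
    simpa using (hlin k).cexp
  have hquad : HasDerivAt (fun t : ℂ => 1 + t * b * (t * c)) 0 0 := by
    simpa using ((hlin b).fun_mul (hlin c)).const_add 1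
  refine ⟨fun t => !![(1 + t * b * (t * c)) * Complex.exp (t * a), t * b * Complex.exp (t * -a);
    t * c * Complex.exp (t * a), Complex.exp (t * -a)], fun t => ?_, fun t => ?_, ?_, ?_⟩
  · rw [differentiableAt_matrix_iff]
    intro i j
    fin_cases i <;> fin_cases j <;> simp <;> fun_prop
  · have h : Complex.exp (t * a) * Complex.exp (t * -a) = 1 := by
      rw [← Complex.exp_add]
      simp
    rw [Matrix.det_fin_two_of]
    linear_combination h
  · simp [Matrix.one_fin_two]
  · rw [hasDerivAt_matrix_iff]
    intro i j
    fin_cases i <;> fin_cases j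
    · simpa using hquad.fun_mul (hexp a)
    · simpa using (hlin b).fun_mul (hexp (-a))
    · simpa using (hlin c).fun_mul (hexp a)
    · simpa [ha] using hexp (-a)

/-- Right multiplication on `M2`, as a continuous linear map depending linearly on the factor. -/
noncomputable def rightMulCLM : M2 →L[ℂ] M2 →L[ℂ] M2 :=
  LinearMap.toContinuousLinearMap
    (LinearMap.toContinuousLinearMap.toLinearMap ∘ₗ (LinearMap.mul ℂ M2).flip)

/-- every holomorphic null curve `ψ` into `sl₂ℂ`, defined on a nonempty
open simply connected set `D`, arises from the Loop Weierstrass Representation: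
there is a family `Φ(λ,z)`, holomorphic in `(λ,z)` with `det Φ ≡ 1`, solving
`∂Φ/∂z = Φ·((λ−λ0)/(λ1−λ0))·ψ′` and such that
`ψ(z) = (λ1−λ0)·(∂Φ/∂λ)(λ0,z)·Φ(λ0,z)⁻¹` on `D`. -/
theorem lwr_local_existence_sl2
    (l0 l1 : ℂ) (hl : l0 ≠ l1)
    (D : Set ℂ) (hD : IsOpen D) (hne : D.Nonempty) (hsc : SimplyConnectedSpace D)
    (ψ ψ' : ℂ → M2)
    (hψ : ∀ z ∈ D, HasDerivAt ψ (ψ' z) z)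
    (htr : ∀ z ∈ D, (ψ z).trace = 0)
    (hnull : ∀ z ∈ D, (ψ' z).det = 0) :
    ∃ Φ : ℂ → ℂ → M2,
      DifferentiableOn ℂ (fun p : ℂ × ℂ => Φ p.1 p.2) (Set.univ ×ˢ D) ∧
      (∀ μ : ℂ, ∀ z ∈ D, (Φ μ z).det = 1) ∧
      (∀ μ : ℂ, ∀ z ∈ D, HasDerivAt (fun w => Φ μ w)
        (Φ μ z * (((μ - l0) / (l1 - l0)) • ψ' z)) z) ∧
      (∀ z ∈ D, ψ z = (l1 - l0) • (deriv (fun l => Φ l z) l0 * (Φ l0 z)⁻¹)) := by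
  have hconn : IsPreconnected D :=
    (IsSimplyConnected.isPathConnected (s := D) hsc).isConnected.isPreconnected
  obtain ⟨z₀, hz₀⟩ := hne
  have hψd : DifferentiableOn ℂ ψ D := fun z hz =>
    (hψ z hz).differentiableAt.differentiableWithinAt
  have hψ'd : DifferentiableOn ℂ ψ' D :=
    (hψd.deriv hD).congr fun z hz => (hψ z hz).deriv.symm
  have htr' : ∀ z ∈ D, (ψ' z).trace = 0 := fun z hz => (hψ z hz).trace_eq_zero hD hz htr
  obtain ⟨F, A, hF, hFz₀, hF0, hFz, hAz₀, hA, hFt⟩ := exists_holomorphic_linear_ode_solution hD hsc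
    (rightMulCLM.differentiable.comp_differentiableOn hψ'd) (1 : M2) hz₀
  obtain ⟨G, hG, hGdet, hG0, hG'⟩ := exists_differentiable_det_eq_one (ψ z₀) (htr z₀ hz₀)
  have hAψ : ∀ z ∈ D, A z = ψ z - ψ z₀ :=
    eqOn_of_hasDerivAt hD hconn (fun z hz => (hA z hz).congr_deriv (one_mul _))
      (fun z hz => (hψ z hz).sub_const _) hz₀
      (by simp [hAz₀])
  have hFz' : ∀ t, ∀ z ∈ D, HasDerivAt (F t) (F t z * (t • ψ' z)) z := fun t z hz =>
    (hFz t z hz).congr_deriv (mul_smul_comm t (F t z) (ψ' z)).symm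
  have hFdet : ∀ t, ∀ z ∈ D, (F t z).det = 1 := fun t =>
    eqOn_of_hasDerivAt hD hconn
      (fun z hz => (hFz' t z hz).det_of_trace_eq_zero (by rw [trace_smul, htr' z hz, smul_zero]))
      (fun z _ => hasDerivAt_const z 1) hz₀ (by simp [hFz₀])
  have hl' : l1 - l0 ≠ 0 := sub_ne_zero.mpr hl.symm
  refine ⟨fun μ z => G ((μ - l0) / (l1 - l0)) * F ((μ - l0) / (l1 - l0)) z, ?_, ?_, ?_, ?_⟩
  · rintro ⟨μ, z⟩ ⟨-, hz⟩
    have hτ : DifferentiableAt ℂ (fun p : ℂ × ℂ => (p.1 - l0) / (l1 - l0)) (μ, z) := by fun_prop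
    refine DifferentiableAt.differentiableWithinAt (DifferentiableAt.matrix_mul ?_ ?_)
    · exact (hG _).comp (μ, z) hτ
    · exact (hF _ z hz).comp (μ, z) (hτ.prodMk differentiableAt_snd)
  · intro μ z hz
    rw [det_mul, hGdet, hFdet _ z hz, one_mul]
  · intro μ z hz
    simpa [mul_assoc] using (hasDerivAt_const z _).matrix_mul (hFz' _ z hz)
  · intro z hz
    have hτ : HasDerivAt (fun l => (l - l0) / (l1 - l0)) (l1 - l0)⁻¹ l0 := by
      simpa using ((hasDerivAt_id l0).sub_const l0).div_const (l1 - l0)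
    have hprod : HasDerivAt (fun t => G t * F t z) (ψ z) ((l0 - l0) / (l1 - l0)) := by
      rw [sub_self, zero_div]
      refine (hG'.matrix_mul (hFt z hz)).congr_deriv ?_
      simp [hF0, hG0, hAψ z hz]
    have hd := (hprod.scomp l0 hτ).deriv
    refine Eq.trans ?_ (congrArg (fun X : M2 => (l1 - l0) • (X *
      (G ((l0 - l0) / (l1 - l0)) * F ((l0 - l0) / (l1 - l0)) z)⁻¹)) hd.symm)
    simp [hF0, hG0, smul_smul, hl']
end

section
/- Under the LWR setup with spinor x, let Φ0(z) := Φ(0,z), let y(z) := Φ0(z)·x(z) with components (u(z), v(z)), let g := u/v and q := u·v′ − v·u′. Then the gauged frame Φ̃(λ,z) := Φ(λ,z)·Φ0(z)⁻¹ satisfies ∂Φ̃/∂z(λ,z) = λ·Φ̃(λ,z)·(y(z)·y(z)^⊥) for all (λ,z); moreover at every z ∈ U where v(z) ≠ 0 and g′(z) ≠ 0, one has y(z)·y(z)^⊥ = (q(z)/g′(z))·((g(z), −g(z)²),(1, −g(z))). (Weierstrass form of the potential.) -/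
open Matrix

attribute [local instance] Matrix.normedAddCommGroup Matrix.normedSpace

/-- The matrix `x·x^⊥` associated with a spinor `x = (u,v)`. -/
noncomputable def spinMat (u v : ℂ) : M2 := !![-(u * v), u ^ 2; -(v ^ 2), u * v]

/-- `y(z) = Φ(0,z)·x(z)`, the spinor moved by the frame at `λ = 0`. -/
noncomputable def Yvec (Φ : ℂ → ℂ → M2) (xu xv : ℂ → ℂ) (w : ℂ) : Fin 2 → ℂ :=
  (Φ 0 w).mulVec ![xu w, xv w]

/-- The Gauss map `g = u/v` built from the components of `y = Φ(0,·)·x`. -/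
noncomputable def Gmap (Φ : ℂ → ℂ → M2) (xu xv : ℂ → ℂ) (w : ℂ) : ℂ :=
  Yvec Φ xu xv w 0 / Yvec Φ xu xv w 1

/-- The function `q = u·v′ − v·u′` built from the components of `y = Φ(0,·)·x`. -/
noncomputable def Qfun (Φ : ℂ → ℂ → M2) (xu xv : ℂ → ℂ) (z : ℂ) : ℂ :=
  Yvec Φ xu xv z 0 * deriv (fun w => Yvec Φ xu xv w 1) z
    - Yvec Φ xu xv z 1 * deriv (fun w => Yvec Φ xu xv w 0) z

theorem hasDerivAt_matrix_iff_s5 {m n : Type*} [Fintype m] [Fintype n]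
    {M : ℂ → Matrix m n ℂ} {M' : Matrix m n ℂ} {z : ℂ} :
    HasDerivAt M M' z ↔ ∀ i j, HasDerivAt (fun w => M w i j) (M' i j) z :=
  hasDerivAt_pi.trans (forall_congr' fun _ => hasDerivAt_pi)

theorem HasDerivAt.matrix_mul_apply {l m n : Type*} [Fintype l] [Fintype m] [Fintype n]
    {M : ℂ → Matrix l m ℂ} {N : ℂ → Matrix m n ℂ} {M' : Matrix l m ℂ} {N' : Matrix m n ℂ} {z : ℂ}
    (hM : HasDerivAt M M' z) (hN : HasDerivAt N N' z) :
    HasDerivAt (fun w => M w * N w) (M' * N z + M z * N') z := by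
  rw [hasDerivAt_matrix_iff_s5] at hM hN ⊢
  intro i j
  simp only [Matrix.add_apply, Matrix.mul_apply, ← Finset.sum_add_distrib]
  exact HasDerivAt.fun_sum fun k _ => (hM i k).mul (hN k j)

theorem HasDerivAt.adjugate_fin_two {M : ℂ → M2} {M' : M2} {z : ℂ} (hM : HasDerivAt M M' z) :
    HasDerivAt (fun w => (M w).adjugate) M'.adjugate z := by
  rw [hasDerivAt_matrix_iff_s5] at hM ⊢
  intro i j
  simp only [Matrix.adjugate_fin_two]
  fin_cases i <;> fin_cases j
  · exact hM 1 1
  · exact (hM 0 1).neg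
  · exact (hM 1 0).neg
  · exact hM 0 0

theorem adjugate_eq_neg_of_trace_eq_zero {M : M2} (hM : M.trace = 0) : M.adjugate = -M := by
  rw [Matrix.trace_fin_two] at hM
  rw [Matrix.adjugate_fin_two]
  ext i j
  fin_cases i <;> fin_cases j <;> simp
  · linear_combination hM
  · linear_combination hM

theorem mul_spinMat_mul_adjugate (P : M2) (a b : ℂ) :
    P * spinMat a b * P.adjugate =
      spinMat (P.mulVec ![a, b] 0) (P.mulVec ![a, b] 1) := by
  rw [Matrix.adjugate_fin_two]
  ext i j
  fin_cases i <;> fin_cases j <;>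
    simp [spinMat, Matrix.mul_apply, Matrix.mulVec, dotProduct, Fin.sum_univ_two] <;> ring

theorem inv_eq_adjugate_of_det_eq_one {P : M2} (hP : P.det = 1) : P⁻¹ = P.adjugate := by
  simp [Matrix.inv_def, hP]

theorem spinMat_eq_smul_of_ne_zero (u : ℂ) {v : ℂ} (hv : v ≠ 0) :
    spinMat u v = (-v ^ 2) • !![u / v, -(u / v) ^ 2; 1, -(u / v)] := by
  ext i j
  fin_cases i <;> fin_cases j <;> simp [spinMat] <;> field_simp

theorem differentiableAt_Yvec {Φ : ℂ → ℂ → M2} {P' : M2} {xu xv : ℂ → ℂ} {z : ℂ}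
    (hΦ : HasDerivAt (fun w => Φ 0 w) P' z) (hxu : DifferentiableAt ℂ xu z)
    (hxv : DifferentiableAt ℂ xv z) (i : Fin 2) :
    DifferentiableAt ℂ (fun w => Yvec Φ xu xv w i) z := by
  have h := hasDerivAt_matrix_iff_s5.mp hΦ i
  simp only [Yvec, Matrix.mulVec, dotProduct, Fin.sum_univ_two]
  exact ((h 0).differentiableAt.mul hxu).add ((h 1).differentiableAt.mul hxv)

theorem deriv_Gmap {Φ : ℂ → ℂ → M2} {xu xv : ℂ → ℂ} {z : ℂ}
    (hu : DifferentiableAt ℂ (fun w => Yvec Φ xu xv w 0) z)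
    (hv : DifferentiableAt ℂ (fun w => Yvec Φ xu xv w 1) z) (hv0 : Yvec Φ xu xv z 1 ≠ 0) :
    deriv (Gmap Φ xu xv) z = -Qfun Φ xu xv z / Yvec Φ xu xv z 1 ^ 2 := by
  refine (hu.hasDerivAt.div hv.hasDerivAt hv0).deriv.trans ?_
  rw [Qfun]
  ring

/-- Weierstrass form of the potential: the gauged frame
`Φ̃(λ,z) := Φ(λ,z)·Φ(0,z)⁻¹` satisfies `∂Φ̃/∂z = λ·Φ̃·(y·y^⊥)` with `y = Φ(0,·)x`;
and wherever `v ≠ 0` and `g′ ≠ 0` (with `g = u/v`, `q = u v′ − v u′`),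
`y·y^⊥ = (q/g′)·((g, −g²),(1, −g))`. -/
theorem lwr_weierstrass_potential
    (U : Set ℂ) (hU : IsOpen U)
    (A B : ℂ → M2) (Φ : ℂ → ℂ → M2)
    (xu xv xu' xv' : ℂ → ℂ)
    (hxu : ∀ z ∈ U, HasDerivAt xu (xu' z) z)
    (hxv : ∀ z ∈ U, HasDerivAt xv (xv' z) z)
    (hspin : ∀ z ∈ U, A z = spinMat (xu z) (xv z))
    (hB : DifferentiableOn ℂ B U)
    (htrB : ∀ z ∈ U, (B z).trace = 0)
    (hΦ : DifferentiableOn ℂ (fun p : ℂ × ℂ => Φ p.1 p.2) (Set.univ ×ˢ U))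
    (hΦdet : ∀ μ : ℂ, ∀ z ∈ U, (Φ μ z).det = 1)
    (hΦz : ∀ μ : ℂ, ∀ z ∈ U, HasDerivAt (fun w => Φ μ w) (Φ μ z * (μ • A z + B z)) z) :
    ∀ z ∈ U,
      (∀ μ : ℂ, HasDerivAt (fun w => Φ μ w * (Φ 0 w)⁻¹)
        (μ • ((Φ μ z * (Φ 0 z)⁻¹) * spinMat (Yvec Φ xu xv z 0) (Yvec Φ xu xv z 1))) z) ∧
      (Yvec Φ xu xv z 1 ≠ 0 → deriv (Gmap Φ xu xv) z ≠ 0 →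
        spinMat (Yvec Φ xu xv z 0) (Yvec Φ xu xv z 1)
          = (Qfun Φ xu xv z / deriv (Gmap Φ xu xv) z) •
            !![Gmap Φ xu xv z, -(Gmap Φ xu xv z) ^ 2; 1, -(Gmap Φ xu xv z)]) := by
  intro z hz
  have hinv (w : ℂ) (hw : w ∈ U) : (Φ 0 w)⁻¹ = (Φ 0 w).adjugate :=
    inv_eq_adjugate_of_det_eq_one (hΦdet 0 w hw)
  refine ⟨fun μ => ?_, fun hv hg => ?_⟩
  · have hadj := (hΦz 0 z hz).adjugate_fin_two
    rw [zero_smul, zero_add, Matrix.adjugate_mul_distrib,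
      adjugate_eq_neg_of_trace_eq_zero (htrB z hz)] at hadj
    have hcancel : (Φ 0 z).adjugate * Φ 0 z = 1 := by
      rw [Matrix.adjugate_mul, hΦdet 0 z hz, one_smul]
    have hprod := (hΦz μ z hz).matrix_mul_apply hadj
    have hloc : (fun w => Φ μ w * (Φ 0 w)⁻¹) =ᶠ[nhds z] fun w => Φ μ w * (Φ 0 w).adjugate := by
      filter_upwards [hU.mem_nhds hz] with w hw
      rw [hinv w hw]
    refine (hprod.congr_of_eventuallyEq hloc).congr_deriv ?_
    have hY : spinMat (Yvec Φ xu xv z 0) (Yvec Φ xu xv z 1) =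
        Φ 0 z * A z * (Φ 0 z).adjugate := by
      rw [hspin z hz, mul_spinMat_mul_adjugate, Yvec]
    have hconj : Φ μ z * (Φ 0 z).adjugate * (Φ 0 z * A z * (Φ 0 z).adjugate) =
        Φ μ z * A z * (Φ 0 z).adjugate := by
      calc _ = Φ μ z * ((Φ 0 z).adjugate * Φ 0 z) * A z * (Φ 0 z).adjugate := by
            simp only [Matrix.mul_assoc]
        _ = _ := by rw [hcancel, Matrix.mul_one]
    rw [hinv z hz, hY, hconj]
    simp only [Matrix.mul_add, Matrix.add_mul, Matrix.mul_smul, Matrix.smul_mul, Matrix.neg_mul,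
      Matrix.mul_neg, Matrix.mul_assoc]
    abel
  · have hdiff := differentiableAt_Yvec (hΦz 0 z hz) (hxu z hz).differentiableAt
      (hxv z hz).differentiableAt
    have hderiv := deriv_Gmap (hdiff 0) (hdiff 1) hv
    have hcoef : Qfun Φ xu xv z / deriv (Gmap Φ xu xv) z = -Yvec Φ xu xv z 1 ^ 2 := by
      rw [div_eq_iff hg, hderiv]
      field_simp
    rw [hcoef, spinMat_eq_smul_of_ne_zero _ hv, Gmap]
end

section
/- Let U ⊆ ℂ be a nonempty open connected set, let q1, q2, s1, s2 : U → ℂ be holomorphic with q1 not identically zero, and for i = 1,2 set η_i(λ,z) := ((0, 1),(λ·q_i(z) + s_i(z), 0)) ∈ M₂(ℂ). Suppose r : U → M₂(ℂ) is holomorphic with det r(z) = 1 for all z and satisfies r′(z) = r(z)·η_2(λ,z) − η_1(λ,z)·r(z) for all λ ∈ ℂ and z ∈ U. Then q1 = q2 and s1 = s2 on U, and r is constantly I or constantly −I. (Uniqueness of the Schwarz form: the gauge between two Schwarz potentials is ± the identity.) -/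
open Matrix

attribute [local instance] Matrix.normedAddCommGroup Matrix.normedSpace

/-- The entries of a differentiable matrix-valued function are differentiable. -/
theorem hasDerivAt_entry {r : ℂ → M2} {r' : M2} {z : ℂ} (h : HasDerivAt r r' z) (i j : Fin 2) :
    HasDerivAt (fun w => r w i j) (r' i j) z :=
  hasDerivAt_pi.1 (hasDerivAt_pi.1 h i) j

/-- Functions agreeing on an open set have equal derivatives there. -/
theorem hasDerivAt_unique_of_eqOn {U : Set ℂ} (hU : IsOpen U) {f g : ℂ → ℂ} {f' g' z : ℂ}
    (hfg : ∀ w ∈ U, f w = g w) (hz : z ∈ U) (hf : HasDerivAt f f' z) (hg : HasDerivAt g g' z) :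
    f' = g' :=
  hf.unique (hg.congr_of_eventuallyEq (Filter.eventually_of_mem (hU.mem_nhds hz) hfg))

/-- uniqueness of the Schwarz form: if `r` is a holomorphic gauge of
determinant `1` between two Schwarz-form potentials
`η_i(λ,z) = ((0,1),(λ·q_i(z)+s_i(z),0))` on a nonempty open connected set `U`,
i.e. `r′ = r·η₂ − η₁·r` for all `λ`, and `q₁` is not identically zero, then
`q₁ = q₂`, `s₁ = s₂`, and `r` is constantly `I` or constantly `−I`. -/
theorem schwarz_form_uniqueness
    (U : Set ℂ) (hU : IsOpen U) (hconn : IsConnected U)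
    (q1 q2 s1 s2 : ℂ → ℂ)
    (hq1 : DifferentiableOn ℂ q1 U) (hq2 : DifferentiableOn ℂ q2 U)
    (hs1 : DifferentiableOn ℂ s1 U) (hs2 : DifferentiableOn ℂ s2 U)
    (hq1ne : ¬ (∀ z ∈ U, q1 z = 0))
    (r r' : ℂ → M2)
    (hr : ∀ z ∈ U, HasDerivAt r (r' z) z)
    (hrdet : ∀ z ∈ U, (r z).det = 1)
    (hgauge : ∀ μ : ℂ, ∀ z ∈ U,
      r' z = r z * !![0, 1; μ * q2 z + s2 z, 0] - !![0, 1; μ * q1 z + s1 z, 0] * r z) :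
    (∀ z ∈ U, q1 z = q2 z) ∧ (∀ z ∈ U, s1 z = s2 z) ∧
    ((∀ z ∈ U, r z = 1) ∨ (∀ z ∈ U, r z = -1)) := by
  have hentry (μ z : ℂ) (hz : z ∈ U) :
      r' z 0 0 = r z 0 1 * (μ * q2 z + s2 z) - r z 1 0 ∧
      r' z 0 1 = r z 0 0 - r z 1 1 ∧
      r' z 1 0 = r z 1 1 * (μ * q2 z + s2 z) - (μ * q1 z + s1 z) * r z 0 0 ∧
      r' z 1 1 = r z 1 0 - (μ * q1 z + s1 z) * r z 0 1 := by
    rw [hgauge μ z hz]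
    simp only [Matrix.sub_apply, Matrix.mul_apply, Fin.sum_univ_two]
    simp
  have hderiv (i j : Fin 2) (z : ℂ) (hz : z ∈ U) :
      HasDerivAt (fun w => r w i j) (r' z i j) z := hasDerivAt_entry (hr z hz) i j
  have hb : ∀ z ∈ U, r z 0 1 = 0 := by
    have hban : AnalyticOnNhd ℂ (fun w => r w 0 1) U := DifferentiableOn.analyticOnNhd
      (fun z hz => (hderiv 0 1 z hz).differentiableAt.differentiableWithinAt) hU
    refine (AnalyticOnNhd.eq_zero_or_eq_zero_of_mul_eq_zero (hq1.analyticOnNhd hU) hban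
      (fun z hz => ?_) hconn.isPreconnected).resolve_left hq1ne
    linear_combination (hentry 1 z hz).2.2.2 - (hentry 0 z hz).2.2.2
  have had : ∀ z ∈ U, r z 0 0 = r z 1 1 := fun z hz => by
    have h := hasDerivAt_unique_of_eqOn hU hb hz (hderiv 0 1 z hz) (hasDerivAt_const z 0)
    linear_combination h - (hentry 0 z hz).2.1
  have hc : ∀ z ∈ U, r z 1 0 = 0 := fun z hz => by
    have h := hasDerivAt_unique_of_eqOn hU had hz (hderiv 0 0 z hz) (hderiv 1 1 z hz)
    obtain ⟨h0, -, -, h1⟩ := hentry 0 z hz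
    rw [hb z hz] at h0 h1
    linear_combination (h0 - h1 - h) / 2
  have hsq : ∀ z ∈ U, r z 0 0 ^ 2 = 1 := fun z hz => by
    have h := hrdet z hz
    rw [Matrix.det_fin_two, hb z hz, ← had z hz] at h
    linear_combination h
  have hne : ∀ z ∈ U, r z 0 0 ≠ 0 := fun z hz h0 => by
    simpa [h0] using hsq z hz
  have hpot (μ z : ℂ) (hz : z ∈ U) : μ * q1 z + s1 z = μ * q2 z + s2 z := by
    have h := hasDerivAt_unique_of_eqOn hU hc hz (hderiv 1 0 z hz) (hasDerivAt_const z 0)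
    have h2 := (hentry μ z hz).2.2.1
    rw [← had z hz] at h2
    exact mul_left_cancel₀ (hne z hz) (by linear_combination h2 - h)
  refine ⟨fun z hz => ?_, fun z hz => ?_, ?_⟩
  · linear_combination hpot 1 z hz - hpot 0 z hz
  · linear_combination hpot 0 z hz
  · have hcont : ContinuousOn (fun w => r w 0 0) U :=
      fun z hz => (hderiv 0 0 z hz).continuousAt.continuousWithinAt
    refine (hconn.isPreconnected.eq_one_or_eq_neg_one_of_sq_eq hcont hsq).imp
      (fun h z hz => ?_) (fun h z hz => ?_)
    all_goals
      have ha := h hz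
      ext i j
      fin_cases i <;> fin_cases j <;> simp_all
end

section
/- Let U ⊆ ℂ be a nonempty open connected set and let S, u, v : U → ℂ be holomorphic with u″ = S·u and v″ = S·v on U. Assume v is not identically zero and u is not a constant scalar multiple of v. Then the Wronskian W := u·v′ − v·u′ is a nonzero constant on U, and for every z0 ∈ U with v(z0) ≠ 0, setting g := u/v on a neighborhood of z0 (so g′(z0) = −W/v(z0)² ≠ 0), one has S(z0) = h(z0)² − h′(z0), where h := g″/(2g′). That is, S equals the Schwarzian derivative of u/v. -/
/-- The Schwarzian derivative `S[g] = (g″/(2g′))² − (g″/(2g′))′`. -/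
noncomputable def schwarzian (g : ℂ → ℂ) (z : ℂ) : ℂ :=
  (deriv (deriv g) z / (2 * deriv g z)) ^ 2
    - deriv (fun w => deriv (deriv g) w / (2 * deriv g w)) z

open Filter Topology in
/-- If `g′ = c / v²` near `z` with `c ≠ 0` and `v z ≠ 0`, then `S[g] = v″ / v` at `z`. -/
theorem schwarzian_of_deriv_eventuallyEq {g v : ℂ → ℂ} {c z : ℂ} (hc : c ≠ 0) (hvz : v z ≠ 0)
    (hv : ∀ᶠ w in 𝓝 z, DifferentiableAt ℂ v w) (hv' : DifferentiableAt ℂ (deriv v) z)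
    (hg : deriv g =ᶠ[𝓝 z] fun w => c / v w ^ 2) :
    schwarzian g z = deriv (deriv v) z / v z := by
  have hne : ∀ᶠ w in 𝓝 z, v w ≠ 0 := hv.self_of_nhds.continuousAt.eventually_ne hvz
  have hpre : (fun w => deriv (deriv g) w / (2 * deriv g w)) =ᶠ[𝓝 z]
      fun w => -(deriv v w / v w) := by
    filter_upwards [hv, hne, hg, hg.eventuallyEq_nhds] with w hvw hw hgw hgw'
    have hd : HasDerivAt (fun w => c / v w ^ 2)
        ((0 * v w ^ 2 - c * (2 * v w * deriv v w)) / (v w ^ 2) ^ 2) w := by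
      have hsq : HasDerivAt (fun w => v w ^ 2) (2 * v w * deriv v w) w := by
        simpa using hvw.hasDerivAt.fun_pow 2
      exact (hasDerivAt_const w c).fun_div hsq (pow_ne_zero 2 hw)
    rw [hgw'.deriv_eq, hd.deriv, hgw]
    field_simp
    ring
  have hd : HasDerivAt (fun w => -(deriv v w / v w))
      (-((deriv (deriv v) z * v z - deriv v z * deriv v z) / v z ^ 2)) z :=
    (hv'.hasDerivAt.fun_div hv.self_of_nhds.hasDerivAt hvz).fun_neg
  have hz := hpre.self_of_nhds
  simp only at hz
  rw [schwarzian, hpre.deriv_eq, hd.deriv, hz]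
  field_simp
  ring

open Filter Topology in
/-- Two holomorphic functions on a connected open set with vanishing Wronskian are
proportional, provided one of them does not vanish somewhere. -/
theorem exists_eq_const_mul_of_wronskian_eq_zero {U : Set ℂ} (hU : IsOpen U)
    (hconn : IsPreconnected U) {u v : ℂ → ℂ}
    (hu : DifferentiableOn ℂ u U) (hv : DifferentiableOn ℂ v U)
    (hW : ∀ z ∈ U, u z * deriv v z - v z * deriv u z = 0) {z : ℂ} (hz : z ∈ U) (hvz : v z ≠ 0) :
    ∃ c : ℂ, ∀ w ∈ U, u w = c * v w := by
  have hva := fun w hw => hv.differentiableAt (hU.mem_nhds hw : U ∈ 𝓝 w)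
  have hua := fun w hw => hu.differentiableAt (hU.mem_nhds hw : U ∈ 𝓝 w)
  have hev : ∀ᶠ w in 𝓝 z, w ∈ U ∧ v w ≠ 0 :=
    (hU.eventually_mem hz).and ((hva z hz).continuousAt.eventually_ne hvz)
  obtain ⟨r, hr, hball⟩ := Metric.eventually_nhds_iff_ball.1 hev
  obtain ⟨c, hc⟩ := Metric.isOpen_ball.exists_is_const_of_deriv_eq_zero
    (f := fun w => u w / v w) (convex_ball z r).isPreconnected
    (fun w hw => ((hua w (hball w hw).1).fun_div (hva w (hball w hw).1)
      (hball w hw).2).differentiableWithinAt)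
    (fun w hw => by
      obtain ⟨hwU, hw0⟩ := hball w hw
      have h := hW w hwU
      rw [deriv_fun_div (hua w hwU) (hva w hwU) hw0, Pi.zero_apply, div_eq_zero_iff]
      left
      linear_combination -h)
  refine ⟨c, (hu.analyticOnNhd hU).eqOn_of_preconnected_of_eventuallyEq
    ((hv.const_mul c).analyticOnNhd hU) hconn hz ?_⟩
  filter_upwards [Metric.ball_mem_nhds z hr] with w hw
  exact (div_eq_iff (hball w hw).2).1 (hc w hw)

/-- if `u″ = S·u` and `v″ = S·v` on a nonempty open connected set `U`,
with `v` not identically zero and `u` not a constant multiple of `v`, then the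
Wronskian `W = u·v′ − v·u′` is a nonzero constant on `U`, and at every `z0 ∈ U`
with `v(z0) ≠ 0`, writing `g = u/v`, one has `g′(z0) = −W/v(z0)² ≠ 0` and
`S(z0) = S[g](z0)`, i.e. `S` equals the Schwarzian derivative of `u/v`. -/
theorem schwarzian_of_ode_quotient
    (U : Set ℂ) (hU : IsOpen U) (hconn : IsConnected U)
    (S u v : ℂ → ℂ)
    (hS : DifferentiableOn ℂ S U)
    (hu : DifferentiableOn ℂ u U) (hu' : DifferentiableOn ℂ (deriv u) U)
    (hv : DifferentiableOn ℂ v U) (hv' : DifferentiableOn ℂ (deriv v) U)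
    (hueq : ∀ z ∈ U, deriv (deriv u) z = S z * u z)
    (hveq : ∀ z ∈ U, deriv (deriv v) z = S z * v z)
    (hvne : ¬ (∀ z ∈ U, v z = 0))
    (hnprop : ∀ c : ℂ, ¬ (∀ z ∈ U, u z = c * v z)) :
    ∃ W : ℂ, W ≠ 0 ∧ (∀ z ∈ U, u z * deriv v z - v z * deriv u z = W) ∧
      ∀ z0 ∈ U, v z0 ≠ 0 →
        deriv (fun w => u w / v w) z0 = -W / (v z0) ^ 2 ∧
        deriv (fun w => u w / v w) z0 ≠ 0 ∧
        S z0 = schwarzian (fun w => u w / v w) z0 := by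
  have hua := fun w hw => hu.differentiableAt (hU.mem_nhds hw : U ∈ nhds w)
  have hva := fun w hw => hv.differentiableAt (hU.mem_nhds hw : U ∈ nhds w)
  have hua' := fun w hw => hu'.differentiableAt (hU.mem_nhds hw : U ∈ nhds w)
  have hva' := fun w hw => hv'.differentiableAt (hU.mem_nhds hw : U ∈ nhds w)
  obtain ⟨W, hW⟩ := hU.exists_is_const_of_deriv_eq_zero
    (f := fun z => u z * deriv v z - v z * deriv u z) hconn.isPreconnected
    ((hu.fun_mul hv').fun_sub (hv.fun_mul hu'))
    (fun z hz => by
      have hd := ((hua z hz).hasDerivAt.fun_mul (hva' z hz).hasDerivAt).fun_sub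
        ((hva z hz).hasDerivAt.fun_mul (hua' z hz).hasDerivAt)
      rw [hd.deriv, hueq z hz, hveq z hz, Pi.zero_apply]
      ring)
  have hW0 : W ≠ 0 := by
    rintro rfl
    push Not at hvne
    obtain ⟨z, hz, hvz⟩ := hvne
    obtain ⟨c, hc⟩ :=
      exists_eq_const_mul_of_wronskian_eq_zero hU hconn.isPreconnected hu hv hW hz hvz
    exact hnprop c hc
  have hderiv : ∀ z ∈ U, v z ≠ 0 → deriv (fun w => u w / v w) z = -W / v z ^ 2 := by
    intro z hz hvz
    rw [deriv_fun_div (hua z hz) (hva z hz) hvz, ← hW z hz]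
    ring
  refine ⟨W, hW0, hW, fun z hz hvz => ⟨hderiv z hz hvz, ?_, ?_⟩⟩
  · rw [hderiv z hz hvz]
    exact div_ne_zero (neg_ne_zero.2 hW0) (pow_ne_zero 2 hvz)
  · have hUz := hU.eventually_mem hz
    rw [schwarzian_of_deriv_eventuallyEq (v := v) (neg_ne_zero.2 hW0) hvz (hUz.mono hva)
      (hva' z hz), hveq z hz, mul_div_cancel_right₀ _ hvz]
    filter_upwards [hUz, (hva z hz).continuousAt.eventually_ne hvz] with w hw hw0
    exact hderiv w hw hw0
end

section
/- Fix λ0 ≠ λ1 ∈ ℂ. Let G be the set of maps R : ℂ → M₂(ℂ) that are complex-differentiable at λ0 with det R(λ) = 1 for all λ and R(λ0) ∈ SU₂. For R ∈ G set ρ(R) := (λ1−λ0)·R′(λ0)·R(λ0)⁻¹ and define φ(R) : M₂(ℂ) → M₂(ℂ) by φ(R)(X) := R(λ0)·X·R(λ0)⁻¹ + ρ(R) + ρ(R)ᴴ. Then for all R, S ∈ G: ρ(RS) = ρ(R) + R(λ0)·ρ(S)·R(λ0)⁻¹, and φ(RS)(X) = φ(R)(φ(S)(X)) for every X ∈ M₂(ℂ);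 that is, φ is a group homomorphism from G (under pointwise matrix multiplication) to the orientation-preserving isometries of Euclidean 3-space. -/
open Matrix

attribute [local instance] Matrix.normedAddCommGroup Matrix.normedSpace

/-- The product rule for matrix-valued functions. -/
theorem HasDerivAt.matrix_mul_fun {R S : ℂ → M2} {R' S' : M2} {z : ℂ}
    (hR : HasDerivAt R R' z) (hS : HasDerivAt S S' z) :
    HasDerivAt (fun μ => R μ * S μ) (R' * S z + R z * S') z := by
  refine hasDerivAt_pi.2 fun i => hasDerivAt_pi.2 fun j => ?_
  have hR (k) := hasDerivAt_pi.1 (hasDerivAt_pi.1 hR i) k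
  have hS (k) := hasDerivAt_pi.1 (hasDerivAt_pi.1 hS k) j
  simpa [Matrix.mul_apply, Finset.sum_add_distrib] using
    HasDerivAt.fun_sum (u := Finset.univ) fun k _ => (hR k).fun_mul (hS k)

/-- rigid-motion homomorphism in Euclidean space: fix `λ0 ≠ λ1`.
For `R` holomorphic at `λ0` with `det R ≡ 1` and `R(λ0) ∈ SU₂`, set
`ρ(R) := (λ1−λ0)·R′(λ0)·R(λ0)⁻¹` and `φ(R)(X) := R(λ0)XR(λ0)⁻¹ + ρ(R) + ρ(R)ᴴ`.
Then for `R, S` as above, with `T'` the derivative of the pointwise product `RS`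
at `λ0`, one has `ρ(RS) = ρ(R) + R(λ0)ρ(S)R(λ0)⁻¹` and
`φ(RS)(X) = φ(R)(φ(S)(X))` for every `X`; that is, `φ` is a group homomorphism
into the orientation-preserving isometries of Euclidean 3-space. -/
theorem rigid_motion_homomorphism_E3
    (l0 l1 : ℂ) (hl : l0 ≠ l1)
    (R S : ℂ → M2) (R' S' T' : M2)
    (hR : HasDerivAt R R' l0) (hS : HasDerivAt S S' l0)
    (hT : HasDerivAt (fun μ => R μ * S μ) T' l0)
    (hRdet : ∀ μ : ℂ, (R μ).det = 1) (hSdet : ∀ μ : ℂ, (S μ).det = 1)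
    (hRu : (R l0)ᴴ * R l0 = 1) (hSu : (S l0)ᴴ * S l0 = 1) :
    (l1 - l0) • (T' * (R l0 * S l0)⁻¹)
      = (l1 - l0) • (R' * (R l0)⁻¹)
        + R l0 * ((l1 - l0) • (S' * (S l0)⁻¹)) * (R l0)⁻¹ ∧
    ∀ X : M2,
      (R l0 * S l0) * X * (R l0 * S l0)⁻¹
          + ((l1 - l0) • (T' * (R l0 * S l0)⁻¹)
            + ((l1 - l0) • (T' * (R l0 * S l0)⁻¹))ᴴ)
        = R l0 * (S l0 * X * (S l0)⁻¹
              + ((l1 - l0) • (S' * (S l0)⁻¹) + ((l1 - l0) • (S' * (S l0)⁻¹))ᴴ))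
            * (R l0)⁻¹
          + ((l1 - l0) • (R' * (R l0)⁻¹) + ((l1 - l0) • (R' * (R l0)⁻¹))ᴴ) := by
  have hT' : T' = R' * S l0 + R l0 * S' := hT.unique (hR.matrix_mul_fun hS)
  have hSS : S l0 * (S l0)⁻¹ = 1 := Matrix.mul_nonsing_inv _ (by simp [hSdet])
  have hRH : ((R l0)⁻¹)ᴴ = R l0 := by
    rw [Matrix.inv_eq_left_inv hRu, Matrix.conjTranspose_conjTranspose]
  have hRH' : (R l0)ᴴ = (R l0)⁻¹ := (Matrix.inv_eq_left_inv hRu).symm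
  have hρ : (l1 - l0) • (T' * (R l0 * S l0)⁻¹)
      = (l1 - l0) • (R' * (R l0)⁻¹)
        + R l0 * ((l1 - l0) • (S' * (S l0)⁻¹)) * (R l0)⁻¹ := by
    rw [hT', Matrix.mul_inv_rev, Matrix.add_mul, Matrix.mul_smul, Matrix.smul_mul, ← smul_add]
    congr 2
    · rw [Matrix.mul_assoc, ← Matrix.mul_assoc (S l0), hSS, Matrix.one_mul]
    · simp only [Matrix.mul_assoc]
  refine ⟨hρ, fun X => ?_⟩
  rw [hρ, Matrix.mul_inv_rev, Matrix.conjTranspose_add, Matrix.conjTranspose_mul,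
    Matrix.conjTranspose_mul, hRH, hRH']
  noncomm_ring
end

section
/- Let c > 0 and γ ∈ ℝ. For a twice differentiable function ω : (0,∞) → ℝ, the following are equivalent: (i) ω″(r) + r⁻¹·ω′(r) = c²·r^{2γ}·e^{−2ω(r)} for all r > 0; (ii) there exist a, b > 0 such that, with α := (1/2)(1 + γ − c/(ab)) and β := (1/2)(1 + γ + c/(ab)), one has ω(r) = log( (1/2)(a²·r^{2α} + b²·r^{2β}) ) for all r > 0. (This is the classification of solutions to the Gauss equation for minimal and CMC 1 intrinsic surfaces of revolution.) -/
/-- Positive-energy solutions of `u″ = c² e^{-2u}` on the line: `e^u` is a sum of two real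
exponentials with positive coefficients. -/
theorem exists_exp_eq_of_liouville {c : ℝ} (hc : 0 < c) {u v : ℝ → ℝ}
    (hu : ∀ t, HasDerivAt u (v t) t)
    (hv : ∀ t, HasDerivAt v (c ^ 2 * Real.exp (-2 * u t)) t) :
    ∃ a b : ℝ, 0 < a ∧ 0 < b ∧ ∀ t, Real.exp (u t) =
      (1 / 2) * (a ^ 2 * Real.exp (-(c / (a * b)) * t) + b ^ 2 * Real.exp (c / (a * b) * t)) := by
  have hE : ∀ t, v t ^ 2 + c ^ 2 * Real.exp (-2 * u t) =
      v 0 ^ 2 + c ^ 2 * Real.exp (-2 * u 0) := by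
    have hd : ∀ t, HasDerivAt (fun t => v t ^ 2 + c ^ 2 * Real.exp (-2 * u t)) 0 t := fun t => by
      refine (((hv t).pow 2).add ((((hu t).const_mul (-2)).exp).const_mul (c ^ 2))).congr_deriv ?_
      push_cast
      ring
    exact fun t => is_const_of_deriv_eq_zero (fun t => (hd t).differentiableAt)
      (fun t => (hd t).deriv) t 0
  set E := v 0 ^ 2 + c ^ 2 * Real.exp (-2 * u 0) with hEdef
  have hEv : v 0 ^ 2 < E := by
    rw [hEdef]
    linarith [mul_pos (pow_pos hc 2) (Real.exp_pos (-2 * u 0))]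
  obtain ⟨k, hk, hkE⟩ : ∃ k, 0 < k ∧ k ^ 2 = E :=
    ⟨√E, Real.sqrt_pos.2 ((sq_nonneg _).trans_lt hEv), Real.sq_sqrt ((sq_nonneg _).trans hEv.le)⟩
  have hvk := abs_lt.1 (abs_lt_of_sq_lt_sq (hEv.trans_eq hkE.symm) hk.le)
  have key : ∀ s : ℝ, s ^ 2 = E → ∀ t,
      Real.exp (u t) * (s + v t) * Real.exp (-s * t) = Real.exp (u 0) * (s + v 0) := by
    intro s hs
    have hd : ∀ t, HasDerivAt (fun t => Real.exp (u t) * (s + v t) * Real.exp (-s * t)) 0 t :=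
      fun t => by
        refine ((((hu t).exp).mul ((hv t).const_add s)).mul
          (((hasDerivAt_id t).const_mul (-s)).exp)).congr_deriv ?_
        simp only [Pi.mul_apply, id]
        linear_combination Real.exp (u t) * Real.exp (-s * t) * (hE t - hs)
    intro t
    simpa using is_const_of_deriv_eq_zero (fun t => (hd t).differentiableAt)
      (fun t => (hd t).deriv) t 0
  set A := Real.exp (u 0) * (k + v 0) with hA
  set B := Real.exp (u 0) * (k - v 0) with hB
  have hA0 : 0 < A := mul_pos (Real.exp_pos _) (by linarith)
  have hB0 : 0 < B := mul_pos (Real.exp_pos _) (by linarith)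
  have hAB : A * B = c ^ 2 := by
    have h2 : Real.exp (u 0) * Real.exp (u 0) * Real.exp (-2 * u 0) = 1 := by
      rw [← Real.exp_add, ← Real.exp_add, ← Real.exp_zero]
      ring_nf
    rw [hA, hB]
    linear_combination Real.exp (u 0) ^ 2 * (hkE + hEdef) + c ^ 2 * h2
  have hsq : √(B / k) * √(A / k) = c / k := by
    rw [← Real.sqrt_mul (by positivity), show B / k * (A / k) = (c / k) ^ 2 by
      rw [div_pow, ← hAB]; ring, Real.sqrt_sq (by positivity)]
  have hck : c / (c / k) = k := by field_simp
  refine ⟨√(B / k), √(A / k), Real.sqrt_pos.2 (by positivity), Real.sqrt_pos.2 (by positivity),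
    fun t => ?_⟩
  rw [hsq, hck, Real.sq_sqrt (by positivity), Real.sq_sqrt (by positivity)]
  have h1 := key k hkE t
  have h2 := key (-k) (by rw [neg_sq, hkE]) t
  have h3 : Real.exp (-k * t) * Real.exp (k * t) = 1 := by
    rw [← Real.exp_add, ← Real.exp_zero]
    ring_nf
  rw [neg_neg] at h2
  have h4 : 2 * k * Real.exp (u t) = B * Real.exp (-k * t) + A * Real.exp (k * t) := by
    linear_combination (-Real.exp (u t) * 2 * k) * h3 + Real.exp (k * t) * h1
      - Real.exp (-k * t) * h2
  rw [eq_comm, show (1 / 2) * (B / k * Real.exp (-k * t) + A / k * Real.exp (k * t)) =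
    (B * Real.exp (-k * t) + A * Real.exp (k * t)) / (2 * k) by ring, ← h4]
  exact mul_div_cancel_left₀ _ (by positivity)

/-- The logarithm of half a sum of two real powers with positive coefficients satisfies a radial
Liouville equation. -/
theorem deriv_deriv_log_rpow_add_rpow {a b : ℝ} (ha : 0 < a) (hb : 0 < b) (p q : ℝ) {r : ℝ}
    (hr : 0 < r) {ω : ℝ → ℝ}
    (hω : ∀ x ∈ Set.Ioi (0 : ℝ),
      ω x = Real.log ((1 / 2) * (a ^ 2 * x ^ p + b ^ 2 * x ^ q))) :
    deriv (deriv ω) r + r⁻¹ * deriv ω r =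
      (a * b * (q - p) / 2) ^ 2 * r ^ (p + q - 2) * Real.exp (-2 * ω r) := by
  have hpow : ∀ (m s : ℝ) {x : ℝ}, 0 < x →
      HasDerivAt (fun x => m * x ^ s) (s * (m * x ^ s) / x) x := fun m s x hx => by
    refine ((Real.hasDerivAt_rpow_const (p := s) (Or.inl hx.ne')).const_mul m).congr_deriv ?_
    rw [Real.rpow_sub_one hx.ne']
    ring
  have hpos : ∀ {x : ℝ}, 0 < x → 0 < a ^ 2 * x ^ p + b ^ 2 * x ^ q := fun {x} hx => by
    have := Real.rpow_pos_of_pos hx p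
    have := Real.rpow_pos_of_pos hx q
    positivity
  have h1 : ∀ x, 0 < x → deriv ω x =
      (p * (a ^ 2 * x ^ p) + q * (b ^ 2 * x ^ q)) / ((a ^ 2 * x ^ p + b ^ 2 * x ^ q) * x) := by
    intro x hx
    have h := (((hpow (a ^ 2) p hx).add (hpow (b ^ 2) q hx)).const_mul (1 / 2)).log
      (mul_pos one_half_pos (hpos hx)).ne'
    have heq : ω =ᶠ[nhds x] fun x => Real.log ((1 / 2) * (a ^ 2 * x ^ p + b ^ 2 * x ^ q)) :=
      Filter.eventuallyEq_of_mem (Ioi_mem_nhds hx) hω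
    have := (hpos hx).ne'
    refine (h.congr_of_eventuallyEq heq).deriv.trans ?_
    simp only [Pi.add_apply]
    field_simp
  have h2 : deriv (deriv ω) r = deriv (fun x =>
      (p * (a ^ 2 * x ^ p) + q * (b ^ 2 * x ^ q)) / ((a ^ 2 * x ^ p + b ^ 2 * x ^ q) * x)) r :=
    Filter.EventuallyEq.deriv_eq (Filter.eventuallyEq_of_mem (Ioi_mem_nhds hr) h1)
  have h3 := (((hpow (a ^ 2) p hr).const_mul p).add ((hpow (b ^ 2) q hr).const_mul q)).div
    (((hpow (a ^ 2) p hr).add (hpow (b ^ 2) q hr)).mul (hasDerivAt_id r))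
    (mul_pos (hpos hr) hr).ne'
  have h4 : Real.exp (-2 * ω r) = ((1 / 2) * (a ^ 2 * r ^ p + b ^ 2 * r ^ q))⁻¹ ^ 2 := by
    rw [hω r hr, neg_mul, Real.exp_neg, two_mul, Real.exp_add,
      Real.exp_log (mul_pos one_half_pos (hpos hr)), mul_inv]
    exact (sq _).symm
  have h5 : r ^ (p + q - 2) = r ^ p * r ^ q / r ^ 2 := by
    rw [Real.rpow_sub hr, Real.rpow_add hr, Real.rpow_two]
  rw [h2, h1 r hr, h4, h5]
  refine (congrArg (· + _) h3.deriv).trans ?_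
  simp only [Pi.add_apply, Pi.mul_apply, id]
  have := (hpos hr).ne'
  generalize r ^ p = X at *
  generalize r ^ q = Y at *
  field_simp
  ring

/-- classification of solutions of the Gauss equation for intrinsic
surfaces of revolution: let `c > 0` and `γ ∈ ℝ`.  For a twice differentiable
function `ω : (0,∞) → ℝ`, the ODE `ω″ + r⁻¹ω′ = c²r^{2γ}e^{−2ω}` holds on `(0,∞)`
if and only if there are `a, b > 0` such that, with
`α = (1/2)(1 + γ − c/(ab))` and `β = (1/2)(1 + γ + c/(ab))`,
`ω(r) = log((1/2)(a²r^{2α} + b²r^{2β}))` for all `r > 0`. -/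
theorem gauss_equation_intrinsic_revolution
    (c γ : ℝ) (hc : 0 < c) (ω : ℝ → ℝ)
    (hω1 : ∀ r ∈ Set.Ioi (0 : ℝ), DifferentiableAt ℝ ω r)
    (hω2 : ∀ r ∈ Set.Ioi (0 : ℝ), DifferentiableAt ℝ (deriv ω) r) :
    (∀ r ∈ Set.Ioi (0 : ℝ),
        deriv (deriv ω) r + r⁻¹ * deriv ω r = c ^ 2 * r ^ (2 * γ) * Real.exp (-2 * ω r))
      ↔
    (∃ a b : ℝ, 0 < a ∧ 0 < b ∧ ∀ r ∈ Set.Ioi (0 : ℝ),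
        ω r = Real.log ((1 / 2) *
          (a ^ 2 * r ^ (2 * ((1 / 2) * (1 + γ - c / (a * b))))
            + b ^ 2 * r ^ (2 * ((1 / 2) * (1 + γ + c / (a * b))))))) := by
  constructor
  · intro h
    obtain ⟨a, b, ha, hb, hab⟩ := exists_exp_eq_of_liouville hc
      (u := fun t => ω (Real.exp t) - (1 + γ) * t)
      (v := fun t => deriv ω (Real.exp t) * Real.exp t - (1 + γ))
      (fun t => by
        refine (((hω1 _ (Real.exp_pos t)).hasDerivAt.comp t (Real.hasDerivAt_exp t)).sub
          ((hasDerivAt_id t).const_mul (1 + γ))).congr_deriv ?_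
        ring)
      (fun t => by
        refine ((((hω2 _ (Real.exp_pos t)).hasDerivAt.comp t (Real.hasDerivAt_exp t)).mul
          (Real.hasDerivAt_exp t)).sub_const (1 + γ)).congr_deriv ?_
        have hode := h _ (Real.exp_pos t)
        have hexp : Real.exp (-2 * (ω (Real.exp t) - (1 + γ) * t)) =
            Real.exp t ^ 2 * Real.exp t ^ (2 * γ) * Real.exp (-2 * ω (Real.exp t)) := by
          rw [← Real.exp_mul, sq, ← Real.exp_add, ← Real.exp_add, ← Real.exp_add]
          ring_nf
        have hinv : Real.exp t * (Real.exp t)⁻¹ = 1 := mul_inv_cancel₀ (Real.exp_pos t).ne'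
        rw [hexp]
        simp only [Function.comp_apply]
        linear_combination Real.exp t ^ 2 * hode
          - Real.exp t * deriv ω (Real.exp t) * hinv)
    refine ⟨a, b, ha, hb, fun r hr => ?_⟩
    have hr : 0 < r := hr
    have key := hab (Real.log r)
    simp only [Real.exp_log hr] at key
    rw [← Real.log_exp (ω r)]
    congr 1
    rw [show ω r = (1 + γ) * Real.log r + (ω r - (1 + γ) * Real.log r) by ring, Real.exp_add, key,
      Real.rpow_def_of_pos hr, Real.rpow_def_of_pos hr,
      show Real.log r * (2 * (1 / 2 * (1 + γ - c / (a * b)))) =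
        (1 + γ) * Real.log r + -(c / (a * b)) * Real.log r by ring,
      show Real.log r * (2 * (1 / 2 * (1 + γ + c / (a * b)))) =
        (1 + γ) * Real.log r + c / (a * b) * Real.log r by ring,
      Real.exp_add, Real.exp_add]
    ring
  · rintro ⟨a, b, ha, hb, h⟩ r hr
    rw [deriv_deriv_log_rpow_add_rpow ha hb _ _ hr h]
    congr 2
    · field_simp
      ring
    · congr 1
      ring
end

section
/- Let M0, M1, M2 ∈ M₂(ℂ) with det M_k = 1 for each k and M0·M1·M2 = I, and let ν0, ν1, ν2 ∈ ℂ be such that e^{2πi·ν_k} is an eigenvalue of M_k (i.e. det(M_k − e^{2πi·ν_k}·I) = 0) for each k. Then the triple {M0, M1, M2} is reducible if and only if ν0 + ε1·ν1 + ε2·ν2 ∈ ℤ for some choice of signs ε1, ε2 ∈ {1, −1}. -/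
open Matrix

/-- A triple of 2×2 matrices is reducible if they have a common eigenvector. -/
def ReducibleTriple (M0 M1 M2' : M2) : Prop :=
  ∃ w : Fin 2 → ℂ, w ≠ 0 ∧
    (∃ μ : ℂ, M0.mulVec w = μ • w) ∧
    (∃ μ : ℂ, M1.mulVec w = μ • w) ∧
    (∃ μ : ℂ, M2'.mulVec w = μ • w)

/-- A `2 × 2` matrix with vanishing determinant is an outer product with nonzero left factor. -/
theorem exists_vecMulVec_of_det_eq_zero {P : M2} (hP : P.det = 0) :
    ∃ u v : Fin 2 → ℂ, u ≠ 0 ∧ P = vecMulVec u v := by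
  obtain ⟨x, hx, hxP⟩ := exists_vecMul_eq_zero_iff.mpr hP
  have hcol (j : Fin 2) : x 0 * P 0 j + x 1 * P 1 j = 0 := by
    simpa [vecMul, dotProduct, Fin.sum_univ_two] using congrFun hxP j
  by_cases h : x 0 = 0
  · have h1 : x 1 ≠ 0 := fun h1 => hx (by ext i; fin_cases i <;> simp [h, h1])
    refine ⟨![1, 0], P 0, fun h => by simpa using congrFun h 0, ?_⟩
    have hrow (j : Fin 2) : P 1 j = 0 := by simpa [h, h1] using hcol j
    ext i j
    fin_cases i <;> simp [vecMulVec_apply, hrow]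
  · refine ⟨![-x 1 / x 0, 1], P 1, fun h => by simpa using congrFun h 1, ?_⟩
    ext i j
    fin_cases i
    · simp only [vecMulVec_apply, Fin.zero_eta, cons_val_zero]
      field_simp
      linear_combination hcol j
    · simp [vecMulVec_apply]

/-- Two singular `2 × 2` matrices whose product is traceless have a common eigenvector. -/
theorem exists_common_eigenvector_of_trace_mul_eq_zero {P Q : M2} (hP : P.det = 0)
    (hQ : Q.det = 0) (h : (P * Q).trace = 0) :
    ∃ w : Fin 2 → ℂ, w ≠ 0 ∧ (∃ μ : ℂ, P *ᵥ w = μ • w) ∧ ∃ μ : ℂ, Q *ᵥ w = μ • w := by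
  obtain ⟨u, v, hu, rfl⟩ := exists_vecMulVec_of_det_eq_zero hP
  obtain ⟨s, t, hs, rfl⟩ := exists_vecMulVec_of_det_eq_zero hQ
  have hvec (a b c : Fin 2 → ℂ) : vecMulVec a b *ᵥ c = (b ⬝ᵥ c) • a := by
    rw [vecMulVec_mulVec, op_smul_eq_smul]
  have hmul : (v ⬝ᵥ s) * (u ⬝ᵥ t) = 0 := by
    simpa [vecMulVec_mul_vecMulVec, trace_vecMulVec] using h
  rcases mul_eq_zero.mp hmul with h | h
  · exact ⟨s, hs, ⟨0, by simp [hvec, h]⟩, _, hvec ..⟩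
  · exact ⟨u, hu, ⟨_, hvec ..⟩, 0, by simp [hvec, dotProduct_comm t, h]⟩

theorem det_sub_smul_one (M : M2) (a : ℂ) :
    (M - a • (1 : M2)).det = a ^ 2 - M.trace * a + M.det := by
  simp [det_fin_two, trace_fin_two]
  ring

theorem det_sub_smul_one_eq_zero_of_mulVec_eq {M : M2} {μ : ℂ} {w : Fin 2 → ℂ} (hw : w ≠ 0)
    (h : M *ᵥ w = μ • w) : (M - μ • (1 : M2)).det = 0 :=
  exists_mulVec_eq_zero_iff.mp ⟨w, hw, by simp [sub_mulVec, smul_mulVec, h]⟩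

theorem trace_eq_add_inv {M : M2} (hM : M.det = 1) {a : ℂ} (ha : a ≠ 0)
    (h : (M - a • (1 : M2)).det = 0) : M.trace = a + a⁻¹ := by
  rw [det_sub_smul_one, hM] at h
  field_simp
  linear_combination -h

theorem eq_or_eq_inv_of_mulVec_eq {M : M2} (hM : M.det = 1) {a : ℂ} (ha : a ≠ 0)
    (h : (M - a • (1 : M2)).det = 0) {μ : ℂ} {w : Fin 2 → ℂ} (hw : w ≠ 0)
    (hμ : M *ᵥ w = μ • w) : μ = a ∨ μ = a⁻¹ := by
  have hdet := det_sub_smul_one_eq_zero_of_mulVec_eq hw hμ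
  rw [det_sub_smul_one, hM, trace_eq_add_inv hM ha h] at hdet
  have hfac : (μ - a) * (μ - a⁻¹) = 0 := by
    linear_combination hdet + mul_inv_cancel₀ ha
  simpa [sub_eq_zero] using hfac

theorem det_sub_inv_smul_one_eq_zero {M : M2} (hM : M.det = 1) {a : ℂ} (ha : a ≠ 0)
    (h : (M - a • (1 : M2)).det = 0) : (M - a⁻¹ • (1 : M2)).det = 0 := by
  rw [det_sub_smul_one, hM, trace_eq_add_inv hM ha h]
  linear_combination -mul_inv_cancel₀ ha

theorem mul_eq_one_of_mulVec_eq {A B C : M2} (hprod : A * B * C = 1) {a b c : ℂ}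
    {w : Fin 2 → ℂ} (hw : w ≠ 0) (ha : A *ᵥ w = a • w) (hb : B *ᵥ w = b • w)
    (hc : C *ᵥ w = c • w) : a * b * c = 1 := by
  have h : (a * b * c) • w = (1 : ℂ) • w := by
    have := congrArg (· *ᵥ w) hprod
    simp only [← mulVec_mulVec, hc, mulVec_smul, hb, ha, one_mulVec, smul_smul,
      ← mul_assoc] at this
    rwa [one_smul, show a * b * c = c * b * a by ring]
  exact smul_left_injective ℂ hw h

/-- Eigenvalues with product one force a triple in `SL₂(ℂ)` with product one to be reducible. -/
theorem reducibleTriple_of_mul_eq_one {A B C : M2} (hA : A.det = 1) (hB : B.det = 1)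
    (hC : C.det = 1) (hprod : A * B * C = 1) {a b c : ℂ} (habc : a * b * c = 1)
    (ha : (A - a • (1 : M2)).det = 0) (hb : (B - b • (1 : M2)).det = 0)
    (hc : (C - c • (1 : M2)).det = 0) : ReducibleTriple A B C := by
  have ha0 : a ≠ 0 := by rintro rfl; simp at habc
  have hb0 : b ≠ 0 := by rintro rfl; simp at habc
  have hc0 : c ≠ 0 := by rintro rfl; simp at habc
  have hCAB : C * (A * B) = 1 := mul_eq_one_comm.mp hprod
  have htr : (A * B).trace = C.trace := by
    have hAB : A * B = C.adjugate := by
      calc A * B = A * B * (C * C.adjugate) := by simp [mul_adjugate, hC]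
        _ = C.adjugate := by rw [← mul_assoc, hprod, one_mul]
    rw [hAB, adjugate_fin_two]
    simp [trace_fin_two, add_comm]
  have hcinv : c = (a * b)⁻¹ := eq_inv_of_mul_eq_one_right habc
  have hPQ : ((A - a • (1 : M2)) * (B - b⁻¹ • (1 : M2))).trace = 0 := by
    have hexp : ((A - a • (1 : M2)) * (B - b⁻¹ • (1 : M2))).trace =
        (A * B).trace - b⁻¹ * A.trace - a * B.trace + 2 * a * b⁻¹ := by
      simp [sub_mul, mul_sub, trace_fin_two]
      ring
    rw [hexp, htr, trace_eq_add_inv hA ha0 ha, trace_eq_add_inv hB hb0 hb,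
      trace_eq_add_inv hC hc0 hc, hcinv]
    field_simp
    ring
  obtain ⟨w, hw, ⟨μ, hμ⟩, ν, hν⟩ := exists_common_eigenvector_of_trace_mul_eq_zero ha
    (det_sub_inv_smul_one_eq_zero hB hb0 hb) hPQ
  have hAw : A *ᵥ w = (μ + a) • w := by
    rw [add_smul, ← hμ]
    simp [sub_mulVec, smul_mulVec]
  have hBw : B *ᵥ w = (ν + b⁻¹) • w := by
    rw [add_smul, ← hν]
    simp [sub_mulVec, smul_mulVec]
  refine ⟨w, hw, ⟨_, hAw⟩, ⟨_, hBw⟩, ((ν + b⁻¹) * (μ + a))⁻¹, ?_⟩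
  have hCw : ((ν + b⁻¹) * (μ + a)) • C *ᵥ w = w := by
    have := congrArg (· *ᵥ w) hCAB
    simpa only [← mulVec_mulVec, hBw, hAw, mulVec_smul, one_mulVec, smul_smul] using this
  have hne : (ν + b⁻¹) * (μ + a) ≠ 0 := by
    intro h
    rw [h, zero_smul] at hCw
    exact hw hCw.symm
  rw [eq_inv_smul_iff₀ hne, hCw]

theorem exp_two_pi_I_mul_eq_one_iff (z : ℂ) :
    Complex.exp (2 * Real.pi * Complex.I * z) = 1 ↔ ∃ n : ℤ, z = n := by
  rw [Complex.exp_eq_one_iff]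
  refine exists_congr fun n => ?_
  rw [mul_comm (n : ℂ), mul_right_inj' Complex.two_pi_I_ne_zero]

/-- An eigenvalue of `M` on a common eigenvector is `exp (2πi ε ν)` for a sign `ε`. -/
theorem exists_sign_of_mulVec_eq {M : M2} (hM : M.det = 1) {ν : ℂ}
    (h : (M - Complex.exp (2 * Real.pi * Complex.I * ν) • (1 : M2)).det = 0) {μ : ℂ}
    {w : Fin 2 → ℂ} (hw : w ≠ 0) (hμ : M *ᵥ w = μ • w) :
    ∃ ε : ℂ, (ε = 1 ∨ ε = -1) ∧ μ = Complex.exp (2 * Real.pi * Complex.I * (ε * ν)) := by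
  rcases eq_or_eq_inv_of_mulVec_eq hM (Complex.exp_ne_zero _) h hw hμ with rfl | rfl
  · exact ⟨1, .inl rfl, by simp⟩
  · exact ⟨-1, .inr rfl, by simp [← Complex.exp_neg]⟩

theorem det_sub_exp_sign_smul_one_eq_zero {M : M2} (hM : M.det = 1) {ν : ℂ}
    (h : (M - Complex.exp (2 * Real.pi * Complex.I * ν) • (1 : M2)).det = 0) {ε : ℂ}
    (hε : ε = 1 ∨ ε = -1) :
    (M - Complex.exp (2 * Real.pi * Complex.I * (ε * ν)) • (1 : M2)).det = 0 := by
  rcases hε with rfl | rfl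
  · simpa using h
  · simpa [← Complex.exp_neg] using det_sub_inv_smul_one_eq_zero hM (Complex.exp_ne_zero _) h

/-- let `M0, M1, M2 ∈ SL₂ℂ` with `M0·M1·M2 = I` and let
`ν0, ν1, ν2 ∈ ℂ` be logarithmic eigenvalues, i.e. `e^{2πiν_k}` is an eigenvalue of
`M_k`.  Then `{M0, M1, M2}` is reducible if and only if
`ν0 ± ν1 ± ν2 ∈ ℤ` for some choice of signs. -/
theorem reducible_iff_log_eigenvalues
    (M0 M1 M2' : M2)
    (h0 : M0.det = 1) (h1 : M1.det = 1) (h2 : M2'.det = 1)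
    (hprod : M0 * M1 * M2' = 1)
    (ν0 ν1 ν2 : ℂ)
    (he0 : (M0 - Complex.exp (2 * Real.pi * Complex.I * ν0) • (1 : M2)).det = 0)
    (he1 : (M1 - Complex.exp (2 * Real.pi * Complex.I * ν1) • (1 : M2)).det = 0)
    (he2 : (M2' - Complex.exp (2 * Real.pi * Complex.I * ν2) • (1 : M2)).det = 0) :
    ReducibleTriple M0 M1 M2' ↔
      ∃ ε1 ε2 : ℂ, (ε1 = 1 ∨ ε1 = -1) ∧ (ε2 = 1 ∨ ε2 = -1) ∧
        ∃ n : ℤ, ν0 + ε1 * ν1 + ε2 * ν2 = (n : ℂ) := by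
  constructor
  · rintro ⟨w, hw, ⟨μ0, hμ0⟩, ⟨μ1, hμ1⟩, μ2, hμ2⟩
    have hμ := mul_eq_one_of_mulVec_eq hprod hw hμ0 hμ1 hμ2
    obtain ⟨ε0, hε0, rfl⟩ := exists_sign_of_mulVec_eq h0 he0 hw hμ0
    obtain ⟨ε1, hε1, rfl⟩ := exists_sign_of_mulVec_eq h1 he1 hw hμ1
    obtain ⟨ε2, hε2, rfl⟩ := exists_sign_of_mulVec_eq h2 he2 hw hμ2
    rw [← Complex.exp_add, ← Complex.exp_add, ← mul_add, ← mul_add,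
      exp_two_pi_I_mul_eq_one_iff] at hμ
    obtain ⟨n, hn⟩ := hμ
    rcases hε0 with rfl | rfl
    · exact ⟨ε1, ε2, hε1, hε2, n, by linear_combination hn⟩
    · refine ⟨-ε1, -ε2, ?_, ?_, -n, by push_cast; linear_combination -hn⟩
      · rcases hε1 with rfl | rfl <;> simp
      · rcases hε2 with rfl | rfl <;> simp
  · rintro ⟨ε1, ε2, hε1, hε2, hn⟩
    refine reducibleTriple_of_mul_eq_one h0 h1 h2 hprod ?_ he0
      (det_sub_exp_sign_smul_one_eq_zero h1 he1 hε1)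
      (det_sub_exp_sign_smul_one_eq_zero h2 he2 hε2)
    rwa [← Complex.exp_add, ← Complex.exp_add, ← mul_add, ← mul_add,
      exp_two_pi_I_mul_eq_one_iff]
end

section
/- Let M0, M1, M2 ∈ M₂(ℂ) with det M_k = 1 for each k and M0·M1·M2 = I. Then the triple {M0, M1, M2} is irreducible and unitarizable if and only if there exist ν0, ν1, ν2 ∈ [0, 1/2] such that e^{2πi·ν_k} is an eigenvalue of M_k for each k and the strict spherical triangle inequalities hold: ν0 < ν1 + ν2, ν1 < ν0 + ν2, ν2 < ν0 + ν1, and ν0 + ν1 + ν2 < 1. -/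
open Matrix

/-- A triple of 2×2 matrices is unitarizable if some `C ∈ SL₂ℂ` simultaneously
conjugates all of them into `SU₂`. -/
def UnitarizableTriple (M0 M1 M2' : M2) : Prop :=
  ∃ C : M2, C.det = 1 ∧
    (C * M0 * C⁻¹)ᴴ * (C * M0 * C⁻¹) = 1 ∧
    (C * M1 * C⁻¹)ᴴ * (C * M1 * C⁻¹) = 1 ∧
    (C * M2' * C⁻¹)ᴴ * (C * M2' * C⁻¹) = 1

open ComplexConjugate

section SphericalTriangle

open Real

lemma four_mul_sin_prod_eq_gram (x y z : ℝ) :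
    4 * (sin (x + y + z) * sin (y + z - x) * sin (x + z - y) * sin (x + y - z)) =
      1 - cos (2 * x) ^ 2 - cos (2 * y) ^ 2 - cos (2 * z) ^ 2 +
        2 * cos (2 * x) * cos (2 * y) * cos (2 * z) := by
  simp only [sin_add, sin_sub, cos_add, cos_two_mul]
  have hx := sin_sq_add_cos_sq x
  have hy := sin_sq_add_cos_sq y
  have hz := sin_sq_add_cos_sq z
  grind

lemma spherical_triangle_iff_gram_pos {x y z : ℝ}
    (hx : x ∈ Set.Icc (0 : ℝ) (1 / 2)) (hy : y ∈ Set.Icc (0 : ℝ) (1 / 2))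
    (hz : z ∈ Set.Icc (0 : ℝ) (1 / 2)) :
    (x < y + z ∧ y < x + z ∧ z < x + y ∧ x + y + z < 1) ↔
      0 < 1 - cos (2 * π * x) ^ 2 - cos (2 * π * y) ^ 2 - cos (2 * π * z) ^ 2 +
        2 * cos (2 * π * x) * cos (2 * π * y) * cos (2 * π * z) := by
  obtain ⟨hx0, hx1⟩ := hx
  obtain ⟨hy0, hy1⟩ := hy
  obtain ⟨hz0, hz1⟩ := hz
  have key := four_mul_sin_prod_eq_gram (π * x) (π * y) (π * z)
  simp only [← mul_add, ← mul_sub] at key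
  rw [mul_assoc 2 π x, mul_assoc 2 π y, mul_assoc 2 π z, ← key]
  have hpos : ∀ t : ℝ, 0 < t → t < 1 → 0 < sin (π * t) := fun t h0 h1 =>
    sin_pos_of_pos_of_lt_pi (by positivity) (by nlinarith [pi_pos])
  have hnonneg : ∀ t : ℝ, 0 ≤ t → t ≤ 1 → 0 ≤ sin (π * t) := fun t h0 h1 =>
    sin_nonneg_of_nonneg_of_le_pi (by positivity) (by nlinarith [pi_pos])
  have hnonpos : ∀ t : ℝ, t ≤ 0 → -1 ≤ t → sin (π * t) ≤ 0 := fun t h0 h1 =>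
    sin_nonpos_of_nonpos_of_neg_pi_le (by nlinarith [pi_pos]) (by nlinarith [pi_pos])
  have hnonpos' : ∀ t : ℝ, 1 ≤ t → t ≤ 2 → sin (π * t) ≤ 0 := fun t h0 h1 => by
    have h := hnonneg (t - 1) (by linarith) (by linarith)
    rw [mul_sub, mul_one, sin_sub_pi] at h
    linarith
  constructor
  · rintro ⟨h1, h2, h3, h4⟩
    have := hpos (x + y + z) (by linarith) h4
    have := hpos (y + z - x) (by linarith) (by linarith)
    have := hpos (x + z - y) (by linarith) (by linarith)
    have := hpos (x + y - z) (by linarith) (by linarith)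
    positivity
  · intro h
    by_contra hcon
    refine absurd h (not_lt.mpr (mul_nonpos_of_nonneg_of_nonpos (by norm_num) ?_))
    by_cases h4 : x + y + z < 1
    · have hs := hnonneg (x + y + z) (by linarith) h4.le
      by_cases h1 : x < y + z
      · have s1 := hnonneg (y + z - x) (by linarith) (by linarith)
        by_cases h2 : y < x + z
        · have s2 := hnonneg (x + z - y) (by linarith) (by linarith)
          have h3 : x + y ≤ z := not_lt.mp fun h3 => hcon ⟨h1, h2, h3, h4⟩
          exact mul_nonpos_of_nonneg_of_nonpos (by positivity)
            (hnonpos _ (by linarith) (by linarith))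
        · have s3 := hnonneg (x + y - z) (by linarith) (by linarith)
          exact mul_nonpos_of_nonpos_of_nonneg (mul_nonpos_of_nonneg_of_nonpos (by positivity)
            (hnonpos _ (by linarith) (by linarith))) s3
      · have s2 := hnonneg (x + z - y) (by linarith) (by linarith)
        have s3 := hnonneg (x + y - z) (by linarith) (by linarith)
        exact mul_nonpos_of_nonpos_of_nonneg (mul_nonpos_of_nonpos_of_nonneg
          (mul_nonpos_of_nonneg_of_nonpos hs (hnonpos _ (by linarith) (by linarith))) s2) s3
    · have s1 := hnonneg (y + z - x) (by linarith) (by linarith)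
      have s2 := hnonneg (x + z - y) (by linarith) (by linarith)
      have s3 := hnonneg (x + y - z) (by linarith) (by linarith)
      exact mul_nonpos_of_nonpos_of_nonneg (mul_nonpos_of_nonpos_of_nonneg
        (mul_nonpos_of_nonpos_of_nonneg (hnonpos' _ (by linarith) (by linarith)) s1) s2) s3

end SphericalTriangle

section TwoByTwo

/-- For `A, B ∈ SL₂`, the determinant of the commutator in terms of traces. -/
lemma det_commutator_eq_trace {A B : M2} (hA : A.det = 1) (hB : B.det = 1) :
    (A * B - B * A).det = 4 - A.trace ^ 2 - B.trace ^ 2 - (A * B).trace ^ 2 +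
      A.trace * B.trace * (A * B).trace := by
  have key : (A * B - B * A).det = 4 * A.det * B.det - A.trace ^ 2 * B.det
      - B.trace ^ 2 * A.det - (A * B).trace ^ 2 + A.trace * B.trace * (A * B).trace := by
    simp only [det_fin_two, trace_fin_two, Matrix.sub_apply, mul_apply, Fin.sum_univ_two]
    ring
  rw [key, hA, hB]
  ring

lemma trace_eq_of_mul_eq_one {A B : M2} (hA : A.det = 1) (h : A * B = 1) :
    B.trace = A.trace := by
  have hB : B = A.adjugate := by
    have h' := congrArg (A.adjugate * ·) h
    simpa [← Matrix.mul_assoc, adjugate_mul, hA] using h'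
  rw [hB, adjugate_fin_two]
  simp [trace_fin_two, add_comm]

lemma det_sub_exp_eq_zero_iff {A : M2} (hA : A.det = 1) (ν : ℝ) :
    (A - Complex.exp (2 * Real.pi * Complex.I * ν) • (1 : M2)).det = 0 ↔
      A.trace = ((2 * Real.cos (2 * Real.pi * ν) : ℝ) : ℂ) := by
  have he : Complex.exp (2 * Real.pi * Complex.I * ν) ≠ 0 := Complex.exp_ne_zero _
  have hcos : ((2 * Real.cos (2 * Real.pi * ν) : ℝ) : ℂ) =
      Complex.exp (2 * Real.pi * Complex.I * ν) + (Complex.exp (2 * Real.pi * Complex.I * ν))⁻¹ := by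
    rw [← Complex.exp_neg]
    push_cast
    rw [Complex.two_cos]
    congr 2 <;> ring
  rw [hcos]
  generalize Complex.exp (2 * Real.pi * Complex.I * ν) = e at he
  have hdet : (A - e • (1 : M2)).det = e * (e + e⁻¹ - A.trace) := by
    rw [det_fin_two] at hA
    simp [det_fin_two, trace_fin_two]
    field_simp
    linear_combination hA
  rw [hdet, mul_eq_zero, or_iff_right he, sub_eq_zero, eq_comm]

lemma unitary_det_one_entries {A : M2} (hA : A.det = 1) (hU : Aᴴ * A = 1) :
    A 1 1 = conj (A 0 0) ∧ A 1 0 = -conj (A 0 1) := by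
  have h : Aᴴ = A.adjugate := by
    have h' := congrArg (· * A.adjugate) hU
    simpa [Matrix.mul_assoc, mul_adjugate, hA] using h'
  rw [adjugate_fin_two] at h
  have h00 := congrFun (congrFun h 0) 0
  have h10 := congrFun (congrFun h 1) 0
  simp [conjTranspose_apply] at h00 h10
  exact ⟨h00.symm, by rw [h10, neg_neg]⟩

lemma unitary_of_entries {A : M2} (hA : A.det = 1)
    (h11 : A 1 1 = conj (A 0 0)) (h10 : A 1 0 = -conj (A 0 1)) : Aᴴ * A = 1 := by
  have h : Aᴴ = A.adjugate := by
    rw [adjugate_fin_two]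
    ext i j
    fin_cases i <;> fin_cases j <;> simp [conjTranspose_apply, h11, h10]
  rw [h, adjugate_mul, hA, one_smul]

lemma unitary_trace {A : M2} (hA : A.det = 1) (hU : Aᴴ * A = 1) :
    A.trace = ((2 * (A 0 0).re : ℝ) : ℂ) ∧ (A 0 0).re ∈ Set.Icc (-1 : ℝ) 1 := by
  obtain ⟨h11, h10⟩ := unitary_det_one_entries hA hU
  constructor
  · rw [trace_fin_two, h11, Complex.add_conj]
  · rw [det_fin_two, h11, h10] at hA
    have := congrArg Complex.re hA
    simp at this
    constructor <;> nlinarith [sq_nonneg (A 0 0).im, sq_nonneg (A 0 1).re, sq_nonneg (A 0 1).im]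

lemma exists_angle_of_unitary {A : M2} (hA : A.det = 1) (hU : Aᴴ * A = 1) :
    ∃ ν ∈ Set.Icc (0 : ℝ) (1 / 2), A.trace = ((2 * Real.cos (2 * Real.pi * ν) : ℝ) : ℂ) := by
  obtain ⟨ht, h1, h2⟩ := unitary_trace hA hU
  have hpi := Real.pi_pos
  refine ⟨Real.arccos (A 0 0).re / (2 * Real.pi), ⟨?_, ?_⟩, ?_⟩
  · have := Real.arccos_nonneg (A 0 0).re
    positivity
  · rw [div_le_iff₀ (by positivity)]
    linarith [Real.arccos_le_pi (A 0 0).re]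
  · rw [mul_div_cancel₀ _ (by positivity), Real.cos_arccos h1 h2, ht]

lemma det_commutator_of_unitary {A B : M2} (hA : A.det = 1) (hB : B.det = 1)
    (hUA : Aᴴ * A = 1) (hUB : Bᴴ * B = 1) :
    ∃ r : ℝ, 0 ≤ r ∧ (A * B - B * A).det = r ∧ (r = 0 → A * B = B * A) := by
  obtain ⟨a11, a10⟩ := unitary_det_one_entries hA hUA
  obtain ⟨b11, b10⟩ := unitary_det_one_entries hB hUB
  set K := A * B - B * A with hK
  have k11 : K 1 1 = -K 0 0 := by
    simp [hK, mul_apply, Fin.sum_univ_two]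
    ring
  have k00 : K 0 0 = -conj (K 0 0) := by
    simp [hK, mul_apply, Fin.sum_univ_two, a10, b10]
    ring
  have k10 : K 1 0 = -conj (K 0 1) := by
    simp [hK, mul_apply, Fin.sum_univ_two, a11, b11, a10, b10]
    ring
  refine ⟨Complex.normSq (K 0 0) + Complex.normSq (K 0 1),
    add_nonneg (Complex.normSq_nonneg _) (Complex.normSq_nonneg _), ?_, fun h => ?_⟩
  · push_cast
    rw [det_fin_two, k11, k10, Complex.normSq_eq_conj_mul_self, Complex.normSq_eq_conj_mul_self]
    linear_combination (-K 0 0) * k00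
  · have h0 := Complex.normSq_nonneg (K 0 0)
    have h1 := Complex.normSq_nonneg (K 0 1)
    have z0 : K 0 0 = 0 := Complex.normSq_eq_zero.mp (by linarith)
    have z1 : K 0 1 = 0 := Complex.normSq_eq_zero.mp (by linarith)
    rw [← sub_eq_zero, ← hK]
    ext i j
    fin_cases i <;> fin_cases j <;> simp [z0, z1, k11, k10]

lemma exists_common_eigenvector_of_commute {A B : M2} (h : A * B = B * A) :
    ∃ w : Fin 2 → ℂ, w ≠ 0 ∧ (∃ μ : ℂ, A *ᵥ w = μ • w) ∧ ∃ μ : ℂ, B *ᵥ w = μ • w := by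
  obtain ⟨μ, hμ⟩ := Module.End.exists_eigenvalue (Matrix.toLin' A)
  have hmaps : ∀ v ∈ Module.End.eigenspace (Matrix.toLin' A) μ,
      Matrix.toLin' B v ∈ Module.End.eigenspace (Matrix.toLin' A) μ := by
    intro v hv
    rw [Module.End.mem_eigenspace_iff, toLin'_apply] at hv ⊢
    rw [toLin'_apply, mulVec_mulVec, h, ← mulVec_mulVec, hv, mulVec_smul]
  have : Nontrivial (Module.End.eigenspace (Matrix.toLin' A) μ) :=
    Submodule.nontrivial_iff_ne_bot.mpr hμ
  obtain ⟨η, hη⟩ := Module.End.exists_eigenvalue ((Matrix.toLin' B).restrict hmaps)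
  obtain ⟨⟨w, hw⟩, hw', hw0⟩ := hη.exists_hasEigenvector
  refine ⟨w, fun h0 => hw0 (Subtype.ext h0), ⟨μ, ?_⟩, ⟨η, ?_⟩⟩
  · rwa [Module.End.mem_eigenspace_iff, toLin'_apply] at hw
  · rw [Module.End.mem_eigenspace_iff] at hw'
    simpa using congrArg Subtype.val hw'

lemma det_commutator_eq_zero_of_common_eigenvector {A B : M2} {w : Fin 2 → ℂ} (hw : w ≠ 0)
    {μ η : ℂ} (hA : A *ᵥ w = μ • w) (hB : B *ᵥ w = η • w) : (A * B - B * A).det = 0 := by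
  refine exists_mulVec_eq_zero_iff.mp ⟨w, hw, ?_⟩
  rw [sub_mulVec, ← mulVec_mulVec, ← mulVec_mulVec, hA, hB, mulVec_smul, mulVec_smul, hA, hB,
    smul_comm, sub_self]

lemma eigenvector_of_mul_eq_one {A B : M2} (hAB : A * B = 1) {w : Fin 2 → ℂ} {μ : ℂ}
    (hw : w ≠ 0) (h : A *ᵥ w = μ • w) : B *ᵥ w = μ⁻¹ • w := by
  have hBA : B *ᵥ (A *ᵥ w) = w := by rw [mulVec_mulVec, mul_eq_one_comm.mp hAB, one_mulVec]
  rw [h, mulVec_smul] at hBA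
  have hμ : μ ≠ 0 := by
    rintro rfl
    exact hw (by simpa using hBA.symm)
  rw [eq_inv_smul_iff₀ hμ, hBA]

lemma reducibleTriple_iff_common_eigenvector {A B C : M2} (h : A * B * C = 1) :
    ReducibleTriple A B C ↔ ∃ w : Fin 2 → ℂ, w ≠ 0 ∧ (∃ μ : ℂ, A *ᵥ w = μ • w) ∧
      ∃ μ : ℂ, B *ᵥ w = μ • w := by
  constructor
  · rintro ⟨w, hw, hA, hB, -⟩
    exact ⟨w, hw, hA, hB⟩
  · rintro ⟨w, hw, ⟨μ, hA⟩, ⟨η, hB⟩⟩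
    refine ⟨w, hw, ⟨μ, hA⟩, ⟨η, hB⟩, ⟨(η * μ)⁻¹, eigenvector_of_mul_eq_one h hw ?_⟩⟩
    rw [← mulVec_mulVec, hB, mulVec_smul, hA, smul_smul]

lemma exists_conj_diagonal {A : M2} {a b : ℂ} (hab : a ≠ b)
    (ha : (A - a • (1 : M2)).det = 0) (hb : (A - b • (1 : M2)).det = 0) :
    ∃ P : M2, P.det = 1 ∧ P * A = diagonal ![a, b] * P := by
  obtain ⟨v, hv, hva⟩ := exists_vecMul_eq_zero_iff.mpr ha
  obtain ⟨w, hw, hwb⟩ := exists_vecMul_eq_zero_iff.mpr hb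
  rw [vecMul_sub, vecMul_smul, vecMul_one, sub_eq_zero] at hva hwb
  have hdet : (of ![v, w]).det ≠ 0 := by
    intro h
    obtain ⟨x, hx, hxP⟩ := exists_vecMul_eq_zero_iff.mpr h
    have e1 : x 0 • v + x 1 • w = 0 := by
      rw [← hxP]
      ext i
      simp [vecMul, dotProduct, Fin.sum_univ_two]
    have e2 : (x 0 * a) • v + (x 1 * b) • w = 0 := by
      have := congrArg (· ᵥ* A) e1
      simpa [add_vecMul, smul_vecMul, hva, hwb, smul_smul] using this
    have e3 : (x 0 * (a - b)) • v = 0 := by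
      have : (x 0 * (a - b)) • v =
          ((x 0 * a) • v + (x 1 * b) • w) - b • (x 0 • v + x 1 • w) := by
        module
      rw [this, e1, e2]
      simp
    have x0 : x 0 = 0 := by
      simpa [hv, sub_ne_zero.mpr hab] using e3
    have x1 : x 1 = 0 := by
      simpa [x0, hw] using e1
    apply hx
    ext i
    fin_cases i <;> simp [x0, x1]
  set δ := (of ![v, w]).det with hδ
  refine ⟨of ![δ⁻¹ • v, w], ?_, ?_⟩
  · rw [← inv_mul_cancel₀ hdet, hδ]
    simp only [det_fin_two, of_apply, cons_val_zero, cons_val_one, Pi.smul_apply, smul_eq_mul]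
    ring
  · ext i j
    have hv' := congrFun hva j
    have hw' := congrFun hwb j
    simp only [vecMul, dotProduct, Fin.sum_univ_two, Pi.smul_apply, smul_eq_mul] at hv' hw'
    fin_cases i
    · simp [mul_apply, Fin.sum_univ_two]
      linear_combination δ⁻¹ * hv'
    · simp [mul_apply, Fin.sum_univ_two]
      exact hw'

lemma exists_diagonal_conj_unitary {A : M2} (hA : A.det = 1) (h11 : A 1 1 = conj (A 0 0))
    {r : ℝ} (hr : r < 0) (hq : A 0 1 * A 1 0 = r) :
    ∃ d : ℂ, d ≠ 0 ∧ (diagonal ![d, d⁻¹] * A * diagonal ![d⁻¹, d])ᴴ *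
      (diagonal ![d, d⁻¹] * A * diagonal ![d⁻¹, d]) = 1 := by
  have hr' : (r : ℂ) ≠ 0 := by exact_mod_cast hr.ne
  have hq0 : A 0 1 ≠ 0 := fun h => hr' (by rw [← hq, h, zero_mul])
  have hn : 0 < Complex.normSq (A 0 1) := Complex.normSq_pos.mpr hq0
  set s : ℝ := -r / Complex.normSq (A 0 1) with hs
  have hs0 : 0 < s := div_pos (by linarith) hn
  have hd4 : √(√s) ^ 4 = s := by
    rw [show (4 : ℕ) = 2 * 2 from rfl, pow_mul, Real.sq_sqrt (Real.sqrt_nonneg _),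
      Real.sq_sqrt hs0.le]
  have hd0 : √(√s) ≠ 0 := (Real.sqrt_pos.mpr (Real.sqrt_pos.mpr hs0)).ne'
  generalize √(√s) = d at hd4 hd0
  have hdC : (d : ℂ) ≠ 0 := by exact_mod_cast hd0
  have h10 : A 1 0 = -conj (A 0 1) * (d : ℂ) ^ 4 := by
    apply mul_left_cancel₀ hq0
    have hn' : (Complex.normSq (A 0 1) : ℂ) ≠ 0 := by exact_mod_cast hn.ne'
    have h4 : (d : ℂ) ^ 4 = -r / Complex.normSq (A 0 1) := by
      rw [← Complex.ofReal_pow, hd4, hs]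
      push_cast
      rfl
    rw [hq, h4, show A 0 1 * (-conj (A 0 1) * (-r / Complex.normSq (A 0 1))) =
      (A 0 1 * conj (A 0 1)) * r / Complex.normSq (A 0 1) by ring, Complex.mul_conj]
    field_simp
  refine ⟨d, hdC, unitary_of_entries ?_ ?_ ?_⟩
  · simp [det_mul, det_diagonal, Fin.prod_univ_two, hA, hdC]
  · simp [diagonal_mul, mul_diagonal, h11]
    field_simp
  · simp [diagonal_mul, mul_diagonal, h10]
    field_simp

lemma conj_mul_conj {A B C : M2} (hC : C.det = 1) :
    C * A * C⁻¹ * (C * B * C⁻¹) = C * (A * B) * C⁻¹ := by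
  have h : C⁻¹ * C = 1 := nonsing_inv_mul C (by simp [hC])
  calc C * A * C⁻¹ * (C * B * C⁻¹) = C * A * (C⁻¹ * C) * B * C⁻¹ := by noncomm_ring
    _ = C * (A * B) * C⁻¹ := by rw [h]; noncomm_ring

lemma exists_simultaneous_conj_unitary {A B : M2} (hA : A.det = 1) (hB : B.det = 1)
    {x y z : ℝ} (hx : A.trace = ((2 * Real.cos x : ℝ) : ℂ)) (hy : B.trace = (y : ℂ))
    (hz : (A * B).trace = (z : ℂ)) {r : ℝ} (hr : 0 < r) (hdet : (A * B - B * A).det = r) :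
    ∃ C : M2, C.det = 1 ∧ (C * A * C⁻¹)ᴴ * (C * A * C⁻¹) = 1 ∧
      (C * B * C⁻¹)ᴴ * (C * B * C⁻¹) = 1 := by
  have hcs : Real.sin x ^ 2 + Real.cos x ^ 2 = 1 := Real.sin_sq_add_cos_sq x
  generalize Real.cos x = c at hx hcs
  generalize Real.sin x = s at hcs
  have hcsC : (s : ℂ) ^ 2 + (c : ℂ) ^ 2 = 1 := by exact_mod_cast hcs
  have hs : s ≠ 0 := by
    rintro rfl
    have h := det_commutator_eq_trace hA hB
    rw [hdet, hx, hy, hz] at h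
    have h' : r = 4 - (2 * c) ^ 2 - y ^ 2 - z ^ 2 + 2 * c * y * z := by exact_mod_cast h
    nlinarith [sq_nonneg (y - c * z)]
  have hsC : (s : ℂ) ≠ 0 := by exact_mod_cast hs
  set a : ℂ := c + s * Complex.I with ha
  set b : ℂ := c - s * Complex.I with hb
  have hconj_a : conj a = b := by simp [ha, hb, sub_eq_add_neg]
  have hconj_b : conj b = a := by rw [← hconj_a, Complex.conj_conj]
  have hab2 : (a - b) ^ 2 = -4 * (s : ℂ) ^ 2 := by
    linear_combination (4 * (s : ℂ) ^ 2) * Complex.I_sq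
  have hab : a ≠ b := by
    intro h
    simp [h, hsC] at hab2
  have hab_mul : a * b = 1 := by linear_combination (-(s : ℂ) ^ 2) * Complex.I_sq + hcsC
  have hab_add : a + b = A.trace := by
    rw [hx, ha, hb]
    push_cast
    ring
  have hchar : ∀ t u : ℂ, t * u = 1 → t + u = A.trace → (A - t • (1 : M2)).det = 0 := by
    intro t u h1 h2
    rw [det_fin_two] at hA
    rw [trace_fin_two] at h2
    simp [det_fin_two]
    linear_combination hA - h1 + t * h2
  obtain ⟨P, hP, hPA⟩ := exists_conj_diagonal hab (hchar a b hab_mul hab_add)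
    (hchar b a (by rw [mul_comm, hab_mul]) (by rw [add_comm, hab_add]))
  have hPu : IsUnit P.det := by simp [hP]
  have hA' : P * A * P⁻¹ = diagonal ![a, b] := by
    rw [hPA, Matrix.mul_assoc, mul_nonsing_inv P hPu, Matrix.mul_one]
  have htrace : ∀ M : M2, (P * M * P⁻¹).trace = M.trace := fun M => by
    rw [trace_mul_comm, ← Matrix.mul_assoc, nonsing_inv_mul P hPu, Matrix.one_mul]
  have hdetP : ∀ M : M2, (P * M * P⁻¹).det = M.det := fun M =>
    det_conj ((isUnit_iff_isUnit_det P).mpr hPu) M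
  set N := P * B * P⁻¹ with hN
  have hNtr : N 0 0 + N 1 1 = y := by rw [← trace_fin_two, htrace, hy]
  have hDN : a * N 0 0 + b * N 1 1 = z := by
    rw [← hz, ← htrace, ← conj_mul_conj hP, hA', ← hN, trace_fin_two]
    simp
  have h11 : N 1 1 = conj (N 0 0) := by
    have e1 := congrArg conj hNtr
    have e2 := congrArg conj hDN
    simp only [map_add, map_mul, Complex.conj_ofReal, hconj_a, hconj_b] at e1 e2
    rw [← sub_eq_zero]
    refine (mul_eq_zero.mp ?_).resolve_left (sub_ne_zero.mpr hab)
    linear_combination a * hNtr - a * e1 - hDN + e2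
  have hoff : N 0 1 * N 1 0 = ((-r / (4 * s ^ 2) : ℝ) : ℂ) := by
    have h : (a - b) ^ 2 * (N 0 1 * N 1 0) = r := by
      rw [← hdet, ← hdetP, Matrix.mul_sub, Matrix.sub_mul, ← conj_mul_conj hP,
        ← conj_mul_conj hP, hA', ← hN, det_fin_two]
      simp
      ring
    rw [hab2] at h
    push_cast
    rw [eq_div_iff (by simpa using hsC)]
    linear_combination -h
  obtain ⟨d, hd, hU⟩ := exists_diagonal_conj_unitary ((hdetP B).trans hB) h11
    (div_neg_of_neg_of_pos (neg_neg_of_pos hr) (by positivity)) hoff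
  have hinv : (diagonal ![d, d⁻¹] * P)⁻¹ = P⁻¹ * diagonal ![d⁻¹, d] := by
    apply inv_eq_right_inv
    calc diagonal ![d, d⁻¹] * P * (P⁻¹ * diagonal ![d⁻¹, d])
        = diagonal ![d, d⁻¹] * (P * P⁻¹) * diagonal ![d⁻¹, d] := by noncomm_ring
      _ = 1 := by
        rw [mul_nonsing_inv P hPu, Matrix.mul_one, diagonal_mul_diagonal, ← diagonal_one]
        congr 1
        ext i
        fin_cases i <;> simp [hd]
  have hconj : ∀ M : M2, diagonal ![d, d⁻¹] * P * M * (diagonal ![d, d⁻¹] * P)⁻¹ =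
      diagonal ![d, d⁻¹] * (P * M * P⁻¹) * diagonal ![d⁻¹, d] := fun M => by
    rw [hinv]
    noncomm_ring
  refine ⟨diagonal ![d, d⁻¹] * P, ?_, ?_, ?_⟩
  · simp [det_mul, hP, hd]
  · have hdiag : diagonal ![d, d⁻¹] * diagonal ![a, b] * diagonal ![d⁻¹, d] =
        diagonal ![a, b] := by
      rw [diagonal_mul_diagonal, diagonal_mul_diagonal]
      congr 1
      ext i
      fin_cases i <;> simp <;> field_simp
    rw [hconj, hA', hdiag]
    apply unitary_of_entries
    · simp [hab_mul]
    · simp [hconj_a]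
    · simp
  · rw [hconj]
    exact hU

lemma conjTranspose_mul_self_of_mul_eq_one {A B : M2} (h : A * B = 1) (hA : Aᴴ * A = 1) :
    Bᴴ * B = 1 := by
  have hB : B = Aᴴ := by
    rw [← Matrix.one_mul B, ← hA, Matrix.mul_assoc, h, Matrix.mul_one]
  rw [hB, conjTranspose_conjTranspose, mul_eq_one_comm.mp hA]

end TwoByTwo

/-- let `M0, M1, M2 ∈ SL₂ℂ` with `M0·M1·M2 = I`.  The triple
`{M0, M1, M2}` is irreducible and unitarizable if and only if there exist
`ν0, ν1, ν2 ∈ [0, 1/2]` with `e^{2πiν_k}` an eigenvalue of `M_k` satisfying the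
strict spherical triangle inequalities
`ν0 < ν1 + ν2`, `ν1 < ν0 + ν2`, `ν2 < ν0 + ν1`, `ν0 + ν1 + ν2 < 1`. -/
theorem irreducible_unitarizable_iff_spherical_triangle
    (M0 M1 M2' : M2)
    (h0 : M0.det = 1) (h1 : M1.det = 1) (h2 : M2'.det = 1)
    (hprod : M0 * M1 * M2' = 1) :
    (¬ ReducibleTriple M0 M1 M2' ∧ UnitarizableTriple M0 M1 M2') ↔
      ∃ ν0 ν1 ν2 : ℝ,
        ν0 ∈ Set.Icc (0 : ℝ) (1 / 2) ∧
        ν1 ∈ Set.Icc (0 : ℝ) (1 / 2) ∧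
        ν2 ∈ Set.Icc (0 : ℝ) (1 / 2) ∧
        (M0 - Complex.exp (2 * Real.pi * Complex.I * ν0) • (1 : M2)).det = 0 ∧
        (M1 - Complex.exp (2 * Real.pi * Complex.I * ν1) • (1 : M2)).det = 0 ∧
        (M2' - Complex.exp (2 * Real.pi * Complex.I * ν2) • (1 : M2)).det = 0 ∧
        ν0 < ν1 + ν2 ∧ ν1 < ν0 + ν2 ∧ ν2 < ν0 + ν1 ∧ ν0 + ν1 + ν2 < 1 := by
  have h01 : (M0 * M1).det = 1 := by rw [det_mul, h0, h1, one_mul]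
  have htr : M2'.trace = (M0 * M1).trace := trace_eq_of_mul_eq_one h01 hprod
  have hgram : ∀ x y z : ℝ, M0.trace = ((2 * Real.cos (2 * Real.pi * x) : ℝ) : ℂ) →
      M1.trace = ((2 * Real.cos (2 * Real.pi * y) : ℝ) : ℂ) →
      M2'.trace = ((2 * Real.cos (2 * Real.pi * z) : ℝ) : ℂ) →
      (M0 * M1 - M1 * M0).det = ((4 * (1 - Real.cos (2 * Real.pi * x) ^ 2
        - Real.cos (2 * Real.pi * y) ^ 2 - Real.cos (2 * Real.pi * z) ^ 2
        + 2 * Real.cos (2 * Real.pi * x) * Real.cos (2 * Real.pi * y) *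
          Real.cos (2 * Real.pi * z)) : ℝ) : ℂ) := by
    intro x y z hx hy hz
    rw [det_commutator_eq_trace h0 h1, ← htr, hx, hy, hz]
    push_cast
    ring
  simp only [det_sub_exp_eq_zero_iff h0, det_sub_exp_eq_zero_iff h1, det_sub_exp_eq_zero_iff h2,
    reducibleTriple_iff_common_eigenvector hprod]
  constructor
  · rintro ⟨hirr, C, hC, hU0, hU1, hU2⟩
    have hCu : IsUnit C.det := by simp [hC]
    have hdet : ∀ M : M2, (C * M * C⁻¹).det = M.det := fun M => det_conj
      ((isUnit_iff_isUnit_det C).mpr hCu) M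
    have htrace : ∀ M : M2, (C * M * C⁻¹).trace = M.trace := fun M => by
      rw [trace_mul_comm, ← Matrix.mul_assoc, nonsing_inv_mul C hCu, Matrix.one_mul]
    obtain ⟨x, hx, hx'⟩ := exists_angle_of_unitary ((hdet _).trans h0) hU0
    obtain ⟨y, hy, hy'⟩ := exists_angle_of_unitary ((hdet _).trans h1) hU1
    obtain ⟨z, hz, hz'⟩ := exists_angle_of_unitary ((hdet _).trans h2) hU2
    rw [htrace] at hx' hy' hz'
    refine ⟨x, y, z, hx, hy, hz, hx', hy', hz', ?_⟩
    rw [spherical_triangle_iff_gram_pos hx hy hz]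
    obtain ⟨r, hr, hrdet, hr0⟩ :=
      det_commutator_of_unitary ((hdet _).trans h0) ((hdet _).trans h1) hU0 hU1
    rw [conj_mul_conj hC, conj_mul_conj hC, ← Matrix.sub_mul, ← Matrix.mul_sub, hdet,
      hgram x y z hx' hy' hz', Complex.ofReal_inj] at hrdet
    rcases hr.eq_or_lt with h | h
    · have hcomm := hr0 h.symm
      rw [conj_mul_conj hC, conj_mul_conj hC] at hcomm
      have hcancel := congrArg (fun M => C⁻¹ * M * C) hcomm
      simp only [Matrix.mul_assoc, nonsing_inv_mul C hCu, Matrix.mul_one] at hcancel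
      simp only [← Matrix.mul_assoc, nonsing_inv_mul C hCu, Matrix.one_mul] at hcancel
      exact absurd (exists_common_eigenvector_of_commute hcancel) hirr
    · linarith
  · rintro ⟨x, y, z, hx, hy, hz, hx', hy', hz', htri⟩
    have hpos := (spherical_triangle_iff_gram_pos hx hy hz).mp htri
    have hdet := hgram x y z hx' hy' hz'
    constructor
    · rintro ⟨w, hw, ⟨μ, hA⟩, ⟨η, hB⟩⟩
      rw [det_commutator_eq_zero_of_common_eigenvector hw hA hB] at hdet
      have := Complex.ofReal_eq_zero.mp hdet.symm
      linarith
    · obtain ⟨C, hC, hU0, hU1⟩ := exists_simultaneous_conj_unitary h0 h1 hx' hy' (htr ▸ hz')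
        (mul_pos four_pos hpos) hdet
      refine ⟨C, hC, hU0, hU1, ?_⟩
      refine conjTranspose_mul_self_of_mul_eq_one (A := C * M0 * C⁻¹ * (C * M1 * C⁻¹)) ?_ ?_
      · rw [conj_mul_conj hC, conj_mul_conj hC, hprod, Matrix.mul_one,
          mul_nonsing_inv C (by simp [hC])]
      · rw [conjTranspose_mul, Matrix.mul_assoc, ← Matrix.mul_assoc _ (C * M0 * C⁻¹), hU0,
          Matrix.one_mul, hU1]
end

section
/- Let A, B ∈ M₂(ℂ) be trace-free matrices, and let q ∈ ℂ with q ≠ 0 and p ∈ ℂ be such that det(λ·A + B) = −(q·λ + p) for all λ ∈ ℂ. Then there exists g ∈ M₂(ℂ) with det g = 1 such that g⁻¹·(λ·A + B)·g = ((0, 1),(q·λ + p, 0)) for all λ ∈ ℂ. (Every constant Fuchsian LWR potential of catenoid type can be gauged by a constant gauge into the standard catenoid form.) -/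
open Matrix

/-- A kernel vector `(x, y)` of the nilpotent part, not an eigenvector of the constant
part, yields the unimodular gauge with columns `B w` and `w`, for `w` a multiple of `(x, y)`. -/
theorem exists_gauge_of_kernel_vector {a b c d e f q p x y : ℂ}
    (hx : a * x + b * y = 0) (hy : c * x - a * y = 0)
    (hq : 2 * a * d + b * f + c * e = q) (hp : d ^ 2 + e * f = p)
    (hD : 2 * d * x * y + e * y ^ 2 - f * x ^ 2 ≠ 0) :
    ∃ g : M2, g.det = 1 ∧
      ∀ μ : ℂ, g⁻¹ * (μ • !![a, b; c, -a] + !![d, e; f, -d]) * g = !![0, 1; q * μ + p, 0] := by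
  obtain ⟨s, hs⟩ := IsAlgClosed.exists_pow_nat_eq
    (2 * d * x * y + e * y ^ 2 - f * x ^ 2)⁻¹ (n := 2) two_pos
  have hs1 : s ^ 2 * (2 * d * x * y + e * y ^ 2 - f * x ^ 2) = 1 := by
    rw [hs, inv_mul_cancel₀ hD]
  have hdet : (!![s * (d * x + e * y), s * x; s * (f * x - d * y), s * y] : M2).det = 1 := by
    rw [det_fin_two_of]
    linear_combination hs1
  refine ⟨_, hdet, fun μ => ?_⟩
  have hconj : (μ • !![a, b; c, -a] + !![d, e; f, -d]) *
      !![s * (d * x + e * y), s * x; s * (f * x - d * y), s * y] =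
      !![s * (d * x + e * y), s * x; s * (f * x - d * y), s * y] * !![0, 1; q * μ + p, 0] := by
    ext i j
    fin_cases i <;> fin_cases j <;> simp [Matrix.mul_apply, Fin.sum_univ_two]
    · linear_combination -(s * μ * d) * hx - (s * μ * e) * hy +
        s * x * μ * hq + s * x * hp
    · linear_combination s * μ * hx
    · linear_combination -(s * μ * f) * hx + (s * μ * d) * hy +
        s * y * μ * hq + s * y * hp
    · linear_combination s * μ * hy
  rw [mul_assoc, hconj, nonsing_inv_mul_cancel_left _ _ (by rw [hdet]; exact isUnit_one)]

/-- let `A, B ∈ sl₂ℂ` and `q ≠ 0`, `p ∈ ℂ` with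
`det(λA + B) = −(qλ + p)` for all `λ`.  Then there is a constant gauge
`g ∈ SL₂ℂ` with `g⁻¹·(λA + B)·g = ((0, 1), (qλ + p, 0))` for all `λ`:
every constant Fuchsian LWR potential of catenoid type can be gauged into the
standard catenoid form. -/
theorem catenoid_type_residue_standard_form
    (A B : M2)
    (htrA : A.trace = 0) (htrB : B.trace = 0)
    (q p : ℂ) (hq : q ≠ 0)
    (hdet : ∀ μ : ℂ, (μ • A + B).det = -(q * μ + p)) :
    ∃ g : M2, g.det = 1 ∧
      ∀ μ : ℂ, g⁻¹ * (μ • A + B) * g = !![0, 1; q * μ + p, 0] := by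
  obtain ⟨a, b, c, a', rfl⟩ : ∃ a b c a', A = !![a, b; c, a'] := ⟨_, _, _, _, A.eta_fin_two⟩
  obtain ⟨d, e, f, d', rfl⟩ : ∃ d e f d', B = !![d, e; f, d'] := ⟨_, _, _, _, B.eta_fin_two⟩
  rw [trace_fin_two_of] at htrA htrB
  obtain rfl : a' = -a := by linear_combination htrA
  obtain rfl : d' = -d := by linear_combination htrB
  have hpoly (μ : ℂ) : (μ * a + d) ^ 2 + (μ * b + e) * (μ * c + f) = q * μ + p := by
    have h := hdet μ
    simp only [det_fin_two, Matrix.add_apply, Matrix.smul_apply, of_apply, cons_val', cons_val_zero,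
      cons_val_one, cons_val_fin_one, smul_eq_mul] at h
    linear_combination -h
  have hnil : a ^ 2 + b * c = 0 := by
    linear_combination (hpoly 1 + hpoly (-1) - 2 * hpoly 0) / 2
  have hlin : 2 * a * d + b * f + c * e = q := by
    linear_combination (hpoly 1 - hpoly (-1)) / 2
  have hp : d ^ 2 + e * f = p := by linear_combination hpoly 0
  by_cases hc : c = 0
  · have ha : a = 0 := by simpa [hc] using hnil
    have hb : b ≠ 0 := by
      rintro rfl
      exact hq (by simpa [ha, hc] using hlin.symm)
    refine exists_gauge_of_kernel_vector (x := b) (y := -a) (by ring)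
      (by linear_combination hnil) hlin hp ?_
    have hD : 2 * d * b * -a + e * (-a) ^ 2 - f * b ^ 2 = -(b * q) := by
      linear_combination e * hnil - b * hlin
    rw [hD]
    exact neg_ne_zero.mpr (mul_ne_zero hb hq)
  · refine exists_gauge_of_kernel_vector (x := a) (y := c) (by linear_combination hnil)
      (by ring) hlin hp ?_
    have hD : 2 * d * a * c + e * c ^ 2 - f * a ^ 2 = c * q := by
      linear_combination c * hlin - f * hnil
    rw [hD]
    exact mul_ne_zero hc hq
end
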